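/- arXiv:1307.8429 — 4 statements merged into one kernel-verified Lean document; each statement's English description precedes it below -/
import Mathlib

section
/- Let c, d be real numbers with c ≠ d and (c,d) ≠ (0,1). Then P_0^⊥(T_1) ∩ P_0^⊥(K_{c,d}) is one-dimensional, spanned by the affine polynomial q_1^{(c,d)}(x,y) := 3(c−d+1)x + 3cy − 2c + d − 1. If (c,d) = (0,1) the intersection has dimension 2. -/
open MeasureTheory Finset

noncomputable section

/-- 2×2 determinant of two vectors in `ℝ²`. -/
def det2 (u v : ℝ × ℝ) : ℝ := u.1 * v.2 - u.2 * v.1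

/-- The open triangle with vertices `A`, `B`, `C` (interior of the convex hull). -/
def tri (A B C : ℝ × ℝ) : Set (ℝ × ℝ) := interior (convexHull ℝ {A, B, C})

/-- Barycentric coordinate of `p` with respect to the vertex `A` of triangle `ABC`. -/
def bary (A B C p : ℝ × ℝ) : ℝ := det2 (p - B) (C - B) / det2 (A - B) (C - B)

/-- The cubic bubble: product of the three barycentric coordinates of triangle `ABC`. -/
def bubble (A B C p : ℝ × ℝ) : ℝ := bary A B C p * bary B C A p * bary C A B p

/-- Evaluation of a bivariate polynomial at a point of `ℝ²`. -/
def evalP (u : MvPolynomial (Fin 2) ℝ) (p : ℝ × ℝ) : ℝ :=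
  MvPolynomial.eval ![p.1, p.2] u

/-- The inner product `(u,v)_K := ∫_K u v ω_K` on the open triangle `K = conv°(A,B,C)`,
with weight the product of the barycentric coordinates. -/
def innerT (A B C : ℝ × ℝ) (u v : MvPolynomial (Fin 2) ℝ) : ℝ :=
  ∫ p in tri A B C, evalP u p * evalP v p * bubble A B C p

/-- `u ∈ P_{n-1}^⊥(K)` for `K = conv°(A,B,C)`: `u` has total degree at most `n` and is
orthogonal to every polynomial of total degree at most `n-1` w.r.t. `(·,·)_K`. -/
def inPerp (n : ℕ) (A B C : ℝ × ℝ) (u : MvPolynomial (Fin 2) ℝ) : Prop :=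
  u.totalDegree ≤ n ∧
    ∀ w : MvPolynomial (Fin 2) ℝ, w.totalDegree ≤ n - 1 → innerT A B C u w = 0

/-- The affine polynomial `q₁^{(c,d)}(x,y) = 3(c-d+1)x + 3cy - 2c + d - 1`. -/
def q1cd (c d : ℝ) : MvPolynomial (Fin 2) ℝ :=
  MvPolynomial.C (3 * (c - d + 1)) * MvPolynomial.X 0 +
    MvPolynomial.C (3 * c) * MvPolynomial.X 1 + MvPolynomial.C (-2 * c + d - 1)

open MvPolynomial in
/-- The affine polynomial `a x + b y + e`. -/
def affinePoly (a b e : ℝ) : MvPolynomial (Fin 2) ℝ := C a * X 0 + C b * X 1 + C e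

theorem evalP_affinePoly (a b e : ℝ) (p : ℝ × ℝ) :
    evalP (affinePoly a b e) p = a * p.1 + b * p.2 + e := by
  simp [evalP, affinePoly]

theorem affinePoly_injective {a b e a' b' e' : ℝ} (h : affinePoly a b e = affinePoly a' b' e') :
    a = a' ∧ b = b' ∧ e = e' := by
  have key (p : ℝ × ℝ) : a * p.1 + b * p.2 + e = a' * p.1 + b' * p.2 + e' := by
    rw [← evalP_affinePoly, ← evalP_affinePoly, h]
  have h0 := key (0, 0)
  have h1 := key (1, 0)
  have h2 := key (0, 1)
  simp only [mul_zero, mul_one, zero_add, add_zero] at h0 h1 h2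
  exact ⟨by linarith, by linarith, h0⟩

theorem smul_affinePoly (t a b e : ℝ) :
    t • affinePoly a b e = affinePoly (t * a) (t * b) (t * e) := by
  simp only [affinePoly, MvPolynomial.smul_eq_C_mul, map_mul]
  ring

theorem affinePoly_add (a b e a' b' e' : ℝ) :
    affinePoly a b e + affinePoly a' b' e' = affinePoly (a + a') (b + b') (e + e') := by
  simp only [affinePoly, map_add]
  ring

theorem totalDegree_affinePoly_le (a b e : ℝ) : (affinePoly a b e).totalDegree ≤ 1 := by
  have hX (r : ℝ) (i : Fin 2) :
      (MvPolynomial.C r * MvPolynomial.X i : MvPolynomial (Fin 2) ℝ).totalDegree ≤ 1 :=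
    (MvPolynomial.totalDegree_mul _ _).trans (by simp)
  exact (MvPolynomial.totalDegree_add _ _).trans (max_le
    ((MvPolynomial.totalDegree_add _ _).trans (max_le (hX a 0) (hX b 1))) (by simp))

theorem exists_eq_affinePoly {u : MvPolynomial (Fin 2) ℝ} (hu : u.totalDegree ≤ 1) :
    ∃ a b e : ℝ, u = affinePoly a b e := by
  classical
  refine ⟨u.coeff (Finsupp.single 0 1), u.coeff (Finsupp.single 1 1), u.coeff 0, ?_⟩
  ext m
  have hdeg : m.degree = m 0 + m 1 := by
    rw [Finsupp.degree_eq_sum, Fin.sum_univ_two]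
  by_cases hm : 1 < m.degree
  · rw [MvPolynomial.coeff_eq_zero_of_totalDegree_lt (hu.trans_lt hm),
      MvPolynomial.coeff_eq_zero_of_totalDegree_lt
        ((totalDegree_affinePoly_le _ _ _).trans_lt hm)]
  · have hcases : m = 0 ∨ m = Finsupp.single 0 1 ∨ m = Finsupp.single 1 1 := by
      rw [hdeg] at hm
      simp only [Finsupp.ext_iff, Fin.forall_fin_two]
      simp
      omega
    rcases hcases with rfl | rfl | rfl <;>
      simp [affinePoly, MvPolynomial.coeff_X, MvPolynomial.coeff_C, Finsupp.single_left_inj,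
        eq_comm (a := (0 : Fin 2 →₀ ℕ))]

/-- The closed reference triangle. -/
def refTriangle : Set (ℝ × ℝ) := {p | 0 ≤ p.1 ∧ 0 ≤ p.2 ∧ p.1 + p.2 ≤ 1}

theorem measurableSet_refTriangle : MeasurableSet refTriangle :=
  (measurableSet_le measurable_const measurable_fst).inter
    ((measurableSet_le measurable_const measurable_snd).inter
      (measurableSet_le (measurable_fst.add measurable_snd) measurable_const))

theorem setIntegral_refTriangle {g : ℝ × ℝ → ℝ} (hg : Continuous g) :
    ∫ p in refTriangle, g p = ∫ x in (0 : ℝ)..1, ∫ y in (0 : ℝ)..(1 - x), g (x, y) := by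
  have hsub : refTriangle ⊆ Set.Icc (0 : ℝ) 1 ×ˢ Set.Icc (0 : ℝ) 1 := fun p hp =>
    ⟨⟨hp.1, by linarith [hp.2.1, hp.2.2]⟩, ⟨hp.2.1, by linarith [hp.1, hp.2.2]⟩⟩
  have hint : IntegrableOn (refTriangle.indicator g) (Set.Icc (0 : ℝ) 1 ×ˢ Set.Icc (0 : ℝ) 1)
      ((volume : Measure ℝ).prod volume) :=
    (hg.continuousOn.integrableOn_compact (isCompact_Icc.prod isCompact_Icc)).indicator
      measurableSet_refTriangle
  rw [← Set.inter_eq_self_of_subset_right hsub,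
    ← setIntegral_indicator measurableSet_refTriangle, Measure.volume_eq_prod,
    setIntegral_prod _ hint, integral_Icc_eq_integral_Ioc,
    ← intervalIntegral.integral_of_le zero_le_one]
  refine intervalIntegral.integral_congr fun x hx => ?_
  rw [Set.uIcc_of_le zero_le_one] at hx
  have hsec : (fun y => refTriangle.indicator g (x, y)) =
      (Set.Icc 0 (1 - x)).indicator fun y => g (x, y) := by
    classical
    funext y
    simp only [Set.indicator_apply]
    refine if_congr ⟨fun h => ⟨h.2.1, by linarith [h.2.2]⟩,
      fun h => ⟨hx.1, h.1, by linarith [h.2]⟩⟩ rfl rfl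
  simp only [hsec]
  rw [setIntegral_indicator measurableSet_Icc,
    Set.inter_eq_self_of_subset_right (Set.Icc_subset_Icc_right (by linarith [hx.1])),
    integral_Icc_eq_integral_Ioc, ← intervalIntegral.integral_of_le (by linarith [hx.2])]

theorem integral_quintic (L c₁ c₂ c₃ c₄ c₅ : ℝ) :
    ∫ t in (0 : ℝ)..L, (c₁ * t + c₂ * t ^ 2 + c₃ * t ^ 3 + c₄ * t ^ 4 + c₅ * t ^ 5) =
      c₁ * L ^ 2 / 2 + c₂ * L ^ 3 / 3 + c₃ * L ^ 4 / 4 + c₄ * L ^ 5 / 5 + c₅ * L ^ 6 / 6 := by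
  rw [intervalIntegral.integral_eq_sub_of_hasDerivAt (f := fun t : ℝ =>
    c₁ * t ^ 2 / 2 + c₂ * t ^ 3 / 3 + c₃ * t ^ 4 / 4 + c₄ * t ^ 5 / 5 + c₅ * t ^ 6 / 6)]
  · simp
  · intro t _
    have h (c : ℝ) (n : ℕ) := ((hasDerivAt_pow n t).const_mul c).div_const (n : ℝ)
    refine (((((h c₁ 2).add (h c₂ 3)).add (h c₃ 4)).add (h c₄ 5)).add (h c₅ 6)).congr_deriv ?_
    norm_num
    ring
  · exact (by fun_prop : Continuous _).intervalIntegrable _ _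

theorem integral_refTriangle_bubble (α β γ : ℝ) :
    ∫ p in refTriangle, (α + β * p.1 + γ * p.2) * ((1 - p.1 - p.2) * p.1 * p.2) =
      (α + (β + γ) / 3) / 120 := by
  rw [setIntegral_refTriangle (by fun_prop)]
  have hinner (x : ℝ) : ∫ y in (0 : ℝ)..(1 - x), (α + β * x + γ * y) * ((1 - x - y) * x * y) =
      (α / 6 + γ / 12) * x + (-3 * α / 6 + β / 6 - 4 * γ / 12) * x ^ 2 +
        (3 * α / 6 - 3 * β / 6 + 6 * γ / 12) * x ^ 3 +
        (-α / 6 + 3 * β / 6 - 4 * γ / 12) * x ^ 4 + (-β / 6 + γ / 12) * x ^ 5 := by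
    have h := integral_quintic (1 - x) (x * (α + β * x) * (1 - x))
      (x * (γ * (1 - x) - (α + β * x))) (-(x * γ)) 0 0
    rw [intervalIntegral.integral_congr (g := fun y => (α + β * x + γ * y) * ((1 - x - y) * x * y))
      (fun y _ => by ring)] at h
    rw [h]
    ring
  simp only [hinner]
  rw [integral_quintic]
  ring

/-- The affine map sending `(0,0)`, `(1,0)`, `(0,1)` to `A`, `B`, `C`. -/
def refMap (A B C p : ℝ × ℝ) : ℝ × ℝ := A + (p.1 • (B - A) + p.2 • (C - A))

/-- The linear part of `refMap`. -/
def refLin (A B C : ℝ × ℝ) : ℝ × ℝ →L[ℝ] ℝ × ℝ :=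
  (ContinuousLinearMap.fst ℝ ℝ ℝ).smulRight (B - A) +
    (ContinuousLinearMap.snd ℝ ℝ ℝ).smulRight (C - A)

theorem refLin_injective {A B C : ℝ × ℝ} (hD : det2 (B - A) (C - A) ≠ 0) :
    Function.Injective (refLin A B C) := by
  refine (injective_iff_map_eq_zero _).2 fun p hp => ?_
  have h1 : p.1 * (B.1 - A.1) + p.2 * (C.1 - A.1) = 0 := congrArg Prod.fst hp
  have h2 : p.1 * (B.2 - A.2) + p.2 * (C.2 - A.2) = 0 := congrArg Prod.snd hp
  simp only [det2, Prod.fst_sub, Prod.snd_sub] at hD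
  refine Prod.ext (mul_right_cancel₀ hD ?_) (mul_right_cancel₀ hD ?_)
  · simp only [Prod.fst_zero]
    linear_combination (C.2 - A.2) * h1 - (C.1 - A.1) * h2
  · simp only [Prod.snd_zero]
    linear_combination (B.1 - A.1) * h2 - (B.2 - A.2) * h1

theorem refLin_det_ne_zero {A B C : ℝ × ℝ} (hD : det2 (B - A) (C - A) ≠ 0) :
    (refLin A B C).det ≠ 0 := fun h =>
  (LinearMap.bot_lt_ker_of_det_eq_zero h).ne'
    (LinearMap.ker_eq_bot.2 (refLin_injective hD))

theorem convexHull_eq_image_refTriangle (A B C : ℝ × ℝ) :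
    convexHull ℝ {A, B, C} = refMap A B C '' refTriangle := by
  ext p
  rw [convexHull_insert (Set.insert_nonempty _ _), convexHull_pair, mem_convexJoin]
  constructor
  · rintro ⟨_, rfl, q, ⟨s, t, hs, ht, hst, rfl⟩, ⟨a, b, ha, hb, hab, rfl⟩⟩
    refine ⟨(b * s, b * t), ⟨mul_nonneg hb hs, mul_nonneg hb ht, ?_⟩, ?_⟩
    · change b * s + b * t ≤ 1
      rw [← mul_add, hst]
      linarith
    · obtain rfl : a = 1 - b := by linarith
      obtain rfl : s = 1 - t := by linarith
      simp only [refMap]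
      module
  · rintro ⟨⟨x, y⟩, ⟨hx, hy, hxy⟩, rfl⟩
    simp only at hx hy hxy
    rcases (add_nonneg hx hy).eq_or_lt with h0 | hpos
    · obtain rfl : x = 0 := by linarith
      obtain rfl : y = 0 := by linarith
      exact ⟨A, rfl, B, left_mem_segment ℝ B C, by simpa [refMap] using left_mem_segment ℝ A B⟩
    · refine ⟨A, rfl, (x / (x + y)) • B + (y / (x + y)) • C,
        ⟨_, _, by positivity, by positivity, by field_simp, rfl⟩,
        ⟨1 - (x + y), x + y, by linarith, hpos.le, by ring, ?_⟩⟩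
      simp only [refMap, smul_add, smul_smul, mul_div_cancel₀ _ hpos.ne']
      module

theorem setIntegral_tri {A B C : ℝ × ℝ} (hD : det2 (B - A) (C - A) ≠ 0) (g : ℝ × ℝ → ℝ) :
    ∫ p in tri A B C, g p =
      |(refLin A B C).det| * ∫ p in refTriangle, g (refMap A B C p) := by
  have hae : tri A B C =ᵐ[volume] convexHull ℝ {A, B, C} :=
    interior_ae_eq_of_null_frontier ((convex_convexHull ℝ _).addHaar_frontier volume)
  have hderiv (p : ℝ × ℝ) : HasFDerivAt (refMap A B C) (refLin A B C) p :=
    (refLin A B C).hasFDerivAt.const_add A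
  have hinj : Function.Injective (refMap A B C) := fun p q h =>
    refLin_injective hD (add_left_cancel h)
  rw [setIntegral_congr_set hae, convexHull_eq_image_refTriangle,
    integral_image_eq_integral_abs_det_fderiv_smul volume measurableSet_refTriangle
      (fun p _ => (hderiv p).hasFDerivWithinAt) hinj.injOn]
  simp only [smul_eq_mul]
  exact integral_const_mul _ _

theorem bubble_refMap {A B C : ℝ × ℝ} (hD : det2 (B - A) (C - A) ≠ 0) (p : ℝ × ℝ) :
    bubble A B C (refMap A B C p) = (1 - p.1 - p.2) * p.1 * p.2 := by
  have e1 : det2 (A - B) (C - B) = -det2 (B - A) (C - A) := by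
    simp only [det2, Prod.fst_sub, Prod.snd_sub]; ring
  have e2 : det2 (B - C) (A - C) = -det2 (B - A) (C - A) := by
    simp only [det2, Prod.fst_sub, Prod.snd_sub]; ring
  have e3 : det2 (C - A) (B - A) = -det2 (B - A) (C - A) := by
    simp only [det2, Prod.fst_sub, Prod.snd_sub]; ring
  have hD' := neg_ne_zero.2 hD
  have hA : bary A B C (refMap A B C p) = 1 - p.1 - p.2 := by
    rw [bary, e1, div_eq_iff hD']
    simp [det2, refMap]; ring
  have hB : bary B C A (refMap A B C p) = p.1 := by
    rw [bary, e2, div_eq_iff hD']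
    simp [det2, refMap]; ring
  have hC : bary C A B (refMap A B C p) = p.2 := by
    rw [bary, e3, div_eq_iff hD']
    simp [det2, refMap]; ring
  rw [bubble, hA, hB, hC]

theorem innerT_affinePoly_C {A B C : ℝ × ℝ} (hD : det2 (B - A) (C - A) ≠ 0) (a b e r : ℝ) :
    innerT A B C (affinePoly a b e) (MvPolynomial.C r) =
      |(refLin A B C).det| * (r *
        (a * (A.1 + B.1 + C.1) + b * (A.2 + B.2 + C.2) + 3 * e)) / 360 := by
  have hC (p : ℝ × ℝ) : evalP (MvPolynomial.C r) p = r := by simp [evalP]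
  have hcomp (p : ℝ × ℝ) : evalP (affinePoly a b e) (refMap A B C p) * r *
      ((1 - p.1 - p.2) * p.1 * p.2) =
      (r * (a * A.1 + b * A.2 + e) + r * (a * (B.1 - A.1) + b * (B.2 - A.2)) * p.1 +
        r * (a * (C.1 - A.1) + b * (C.2 - A.2)) * p.2) * ((1 - p.1 - p.2) * p.1 * p.2) := by
    rw [evalP_affinePoly]
    simp only [refMap, Prod.fst_add, Prod.snd_add, Prod.smul_fst, Prod.smul_snd, Prod.fst_sub,
      Prod.snd_sub, smul_eq_mul]
    ring
  rw [innerT, setIntegral_tri hD]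
  simp only [hC, bubble_refMap hD, hcomp, integral_refTriangle_bubble]
  ring

/-- An affine polynomial is orthogonal to the constants iff it vanishes at the centroid. -/
theorem inPerp_one_affinePoly_iff {A B C : ℝ × ℝ} (hD : det2 (B - A) (C - A) ≠ 0) (a b e : ℝ) :
    inPerp 1 A B C (affinePoly a b e) ↔
      a * (A.1 + B.1 + C.1) + b * (A.2 + B.2 + C.2) + 3 * e = 0 := by
  constructor
  · intro h
    have h1 := h.2 (MvPolynomial.C 1) (by simp)
    rw [innerT_affinePoly_C hD, one_mul] at h1
    simpa [refLin_det_ne_zero hD] using h1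
  · refine fun h => ⟨totalDegree_affinePoly_le a b e, fun w hw => ?_⟩
    rw [MvPolynomial.totalDegree_eq_zero_iff_eq_C.1 (Nat.le_zero.1 hw), innerT_affinePoly_C hD, h]
    simp

theorem inPerp_inter_iff {c d : ℝ} (hcd : c ≠ d) (a b e : ℝ) :
    (inPerp 1 (0, 0) (1, 0) (0, 1) (affinePoly a b e) ∧
      inPerp 1 (1, 0) (0, 0) (-c / (d - c), 1 / (d - c)) (affinePoly a b e)) ↔
      a + b + 3 * e = 0 ∧ a * (d - 2 * c) + b + 3 * e * (d - c) = 0 := by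
  have hdc : d - c ≠ 0 := sub_ne_zero.2 hcd.symm
  rw [inPerp_one_affinePoly_iff (by simp [det2]),
    inPerp_one_affinePoly_iff (by simp [det2, hdc])]
  refine and_congr (by simp) ?_
  rw [← mul_left_inj' hdc, zero_mul]
  refine Eq.congr ?_ rfl
  field_simp
  ring

theorem q1cd_eq_affinePoly (c d : ℝ) :
    q1cd c d = affinePoly (3 * (c - d + 1)) (3 * c) (-2 * c + d - 1) := rfl

/-- Let `c ≠ d`.  If `(c,d) ≠ (0,1)` then `P_0^⊥(T₁) ∩ P_0^⊥(K_{c,d})` is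
one-dimensional, spanned by `q₁^{(c,d)}`; if `(c,d) = (0,1)` the intersection has
dimension `2`. -/
theorem statement8 (c d : ℝ) (hcd : c ≠ d) :
    (¬(c = 0 ∧ d = 1) →
      q1cd c d ≠ 0 ∧
        ∀ u : MvPolynomial (Fin 2) ℝ,
          (inPerp 1 (0, 0) (1, 0) (0, 1) u ∧
              inPerp 1 (1, 0) (0, 0) (-c / (d - c), 1 / (d - c)) u) ↔
            ∃ t : ℝ, u = t • q1cd c d) ∧
    ((c = 0 ∧ d = 1) →
      ∃ u₁ u₂ : MvPolynomial (Fin 2) ℝ, LinearIndependent ℝ ![u₁, u₂] ∧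
        ∀ u : MvPolynomial (Fin 2) ℝ,
          (inPerp 1 (0, 0) (1, 0) (0, 1) u ∧
              inPerp 1 (1, 0) (0, 0) (-c / (d - c), 1 / (d - c)) u) ↔
            ∃ s t : ℝ, u = s • u₁ + t • u₂) := by
  refine ⟨fun hne => ⟨fun h0 => ?_, fun u => ⟨?_, ?_⟩⟩, ?_⟩
  · have hzero : q1cd c d = affinePoly 0 0 0 := by simp [h0, affinePoly]
    rw [q1cd_eq_affinePoly] at hzero
    obtain ⟨h1, h2, -⟩ := affinePoly_injective hzero
    exact hne ⟨by linarith, by linarith⟩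
  · rintro hu
    obtain ⟨a, b, e, rfl⟩ := exists_eq_affinePoly hu.1.1
    obtain ⟨h1, h2⟩ := (inPerp_inter_iff hcd a b e).1 hu
    simp only [q1cd_eq_affinePoly, smul_affinePoly]
    by_cases hc : c = 0
    · subst hc
      have hd : 1 - d ≠ 0 := fun h => hne ⟨rfl, by linarith⟩
      have hb : b = 0 := mul_right_cancel₀ hd (by linear_combination h2 - d * h1)
      refine ⟨a / (3 * (1 - d)), ?_⟩
      congr 1
      · field_simp
        ring
      · simp [hb]
      · field_simp
        linear_combination (1 - d) * (h1 - hb)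
    · refine ⟨b / (3 * c), ?_⟩
      have ha : a * c = b * (c - d + 1) := by linear_combination (d - c) * h1 - h2
      congr 1
      · field_simp
        linear_combination ha
      · field_simp
      · field_simp
        linear_combination c * h1 - ha
  · rintro ⟨t, rfl⟩
    rw [q1cd_eq_affinePoly, smul_affinePoly, inPerp_inter_iff hcd]
    constructor <;> ring
  · rintro ⟨rfl, rfl⟩
    refine ⟨affinePoly 3 0 (-1), affinePoly 0 3 (-1), ?_, fun u => ⟨?_, ?_⟩⟩
    · rw [LinearIndependent.pair_iff]
      intro s t h
      rw [smul_affinePoly, smul_affinePoly, affinePoly_add,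
        show (0 : MvPolynomial (Fin 2) ℝ) = affinePoly 0 0 0 by simp [affinePoly]] at h
      obtain ⟨h1, h2, -⟩ := affinePoly_injective h
      exact ⟨by linarith, by linarith⟩
    · intro hu
      obtain ⟨a, b, e, rfl⟩ := exists_eq_affinePoly hu.1.1
      obtain ⟨h1, -⟩ := (inPerp_inter_iff hcd a b e).1 hu
      refine ⟨a / 3, b / 3, ?_⟩
      rw [smul_affinePoly, smul_affinePoly, affinePoly_add]
      congr 1 <;> linarith
    · rintro ⟨s, t, rfl⟩
      rw [smul_affinePoly, smul_affinePoly, affinePoly_add, inPerp_inter_iff hcd]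
      constructor <;> ring
end
end

section
/- For n ≥ 1 define q_n(x,y) := ( P_{n+1}^{(1,1)}(1−2(x+y)) − P_{n+1}^{(1,1)}(1−2x) ) / y. Then: (i) q_n is a bivariate polynomial of total degree n; (ii) q_n(x+y, −y) = q_n(x,y) for all (x,y); (iii) ∫∫_{T_1} q_n(x,y) r(x,y) · x y (1−x−y) dx dy = 0 for every bivariate polynomial r of total degree ≤ n−1. Consequently q_n ∈ P_{n−1}^⊥(T_1) ∩ P_{n−1}^⊥(K_{1,0}), where K_{1,0} = conv°((1,0),(0,0),(1,−1)). -/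
open MeasureTheory Finset

noncomputable section

/-- Shifted factorial (Pochhammer symbol) `(a)_k = a (a+1) ⋯ (a+k-1)`. -/
def poch (a : ℝ) (k : ℕ) : ℝ := ∏ j ∈ Finset.range k, (a + j)

/-- The Jacobi polynomial `P_n^{(a,b)}` as a univariate real polynomial,
`P_n^{(a,b)}(x) = ((a+1)_n/n!) Σ_{k=0}^n ((-n)_k (n+a+b+1)_k)/((a+1)_k k!) ((1-x)/2)^k`. -/
def jacobiPoly (n : ℕ) (a b : ℝ) : Polynomial ℝ :=
  Polynomial.C (poch (a + 1) n / (n.factorial : ℝ)) *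
    ∑ k ∈ Finset.range (n + 1),
      Polynomial.C (poch (-(n : ℝ)) k * poch ((n : ℝ) + a + b + 1) k /
          (poch (a + 1) k * (k.factorial : ℝ))) *
        (Polynomial.C (2⁻¹ : ℝ) * (1 - Polynomial.X)) ^ k

/-- The value `P_n^{(a,b)}(x)` of the Jacobi polynomial. -/
def jacobiR (n : ℕ) (a b x : ℝ) : ℝ := (jacobiPoly n a b).eval x

/-- Substitute a bivariate polynomial into a univariate polynomial. -/
def substX (f : Polynomial ℝ) (g : MvPolynomial (Fin 2) ℝ) : MvPolynomial (Fin 2) ℝ :=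
  Polynomial.aeval g f

lemma poch_two (k : ℕ) : poch 2 k = ((k + 1).factorial : ℝ) := by
  induction k with
  | zero => simp [poch]
  | succ k ih =>
    rw [poch, prod_range_succ, ← poch, ih, Nat.factorial_succ (k + 1)]
    push_cast
    ring

lemma poch_natCast_succ (m k : ℕ) :
    poch ((m : ℝ) + 1) k * (m.factorial : ℝ) = ((m + k).factorial : ℝ) := by
  induction k with
  | zero => simp [poch]
  | succ k ih =>
    rw [poch, prod_range_succ, ← poch, mul_right_comm, ih, ← add_assoc, Nat.factorial_succ (m + k)]
    push_cast
    ring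

lemma poch_neg_natCast (m k : ℕ) (hk : k ≤ m) :
    poch (-(m : ℝ)) k = (-1) ^ k * (m.choose k : ℝ) * (k.factorial : ℝ) := by
  have h : poch (-(m : ℝ)) k = (-1) ^ k * (m.descFactorial k : ℝ) := by
    induction k with
    | zero => simp [poch]
    | succ k ih =>
      rw [poch, prod_range_succ, ← poch, ih (by omega), Nat.descFactorial_succ, Nat.cast_mul,
        Nat.cast_sub (by omega)]
      ring
  rw [h, Nat.descFactorial_eq_factorial_mul_choose]
  push_cast
  ring

/-- The coefficient of `t ^ k` in `P_m^{(1,1)}(1 - 2 t)`, up to the normalising factor. -/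
def jacobiCoeff (m k : ℕ) : ℝ :=
  poch (-(m : ℝ)) k * poch ((m : ℝ) + 1 + 1 + 1) k / (poch (1 + 1) k * (k.factorial : ℝ))

lemma jacobiCoeff_eq (m k : ℕ) (hk : k ≤ m) :
    jacobiCoeff m k = ((m + 2).factorial : ℝ)⁻¹ *
      ((-1) ^ k * (m.choose k : ℝ) * ∏ i ∈ range (m + 1), ((k : ℝ) + (i + 2))) := by
  have h1 : poch ((k + 1 : ℕ) + 1 : ℝ) (m + 1) * ((k + 1).factorial : ℝ)
      = poch ((m + 2 : ℕ) + 1 : ℝ) k * ((m + 2).factorial : ℝ) := by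
    rw [poch_natCast_succ, poch_natCast_succ]
    congr 2
    omega
  have h2 : ∏ i ∈ range (m + 1), ((k : ℝ) + (i + 2)) = poch ((k + 1 : ℕ) + 1 : ℝ) (m + 1) := by
    refine prod_congr rfl fun i _ => ?_
    push_cast
    ring
  have h3 : (m : ℝ) + 1 + 1 + 1 = (m + 2 : ℕ) + 1 := by push_cast; ring
  rw [jacobiCoeff, h2, h3, one_add_one_eq_two, poch_two, poch_neg_natCast m k hk]
  have f1 : ((k + 1).factorial : ℝ) ≠ 0 := by positivity
  have f2 : (k.factorial : ℝ) ≠ 0 := by positivity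
  have f3 : ((m + 2).factorial : ℝ) ≠ 0 := by positivity
  field_simp
  linear_combination (-(m.choose k : ℝ)) * h1

lemma sum_jacobiCoeff_div (m j : ℕ) (hj : j < m) :
    ∑ k ∈ range (m + 1), jacobiCoeff m k / (((k : ℝ) + (j + 2)) * ((k : ℝ) + (j + 3))) = 0 := by
  set s := ((range (m + 1)).erase j).erase (j + 1)
  set P : Polynomial ℝ := ∏ i ∈ s, (Polynomial.X + Polynomial.C ((i : ℝ) + 2)) with hP
  have hjm : j ∈ range (m + 1) := by simp; omega
  have hjm' : j + 1 ∈ (range (m + 1)).erase j := by simp; omega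
  have hdeg : P.natDegree < m := by
    have hc : s.card = m - 1 := by
      rw [card_erase_of_mem hjm', card_erase_of_mem hjm, card_range]
      rfl
    rw [hP, Polynomial.natDegree_prod_of_monic _ _ fun i _ => Polynomial.monic_X_add_C _]
    simp only [Polynomial.natDegree_X_add_C, sum_const, smul_eq_mul, mul_one, hc]
    omega
  have hz := congr_fun (Polynomial.fwdDiff_iter_eq_zero_of_degree_lt hdeg) 0
  rw [fwdDiff_iter_eq_sum_shift, Pi.zero_apply] at hz
  have hfac : ∀ k : ℕ, ∏ i ∈ range (m + 1), ((k : ℝ) + (i + 2))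
      = ((k : ℝ) + (j + 2)) * ((k : ℝ) + (j + 3)) * P.eval (k : ℝ) := by
    intro k
    rw [← mul_prod_erase _ _ hjm, ← mul_prod_erase _ _ hjm', hP, Polynomial.eval_prod]
    simp only [Polynomial.eval_add, Polynomial.eval_X, Polynomial.eval_C]
    push_cast
    ring
  calc _ = ((m + 2).factorial : ℝ)⁻¹ * (-1) ^ m * ∑ k ∈ range (m + 1),
        ((-1 : ℤ) ^ (m - k) * (m.choose k : ℤ)) • P.eval (0 + k • (1 : ℝ)) := by
        rw [mul_sum]
        refine sum_congr rfl fun k hk => ?_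
        have hk : k ≤ m := by simpa [Nat.lt_succ_iff] using hk
        rw [jacobiCoeff_eq m k hk, hfac k]
        have h1 : ((k : ℝ) + (j + 2)) ≠ 0 := by positivity
        have h2 : ((k : ℝ) + (j + 3)) ≠ 0 := by positivity
        have hs : (-1 : ℝ) ^ m * (-1) ^ (m - k) = (-1) ^ k := by
          obtain ⟨l, rfl⟩ := Nat.exists_eq_add_of_le hk
          rw [Nat.add_sub_cancel_left, pow_add, mul_assoc, ← mul_pow]
          simp
        rw [zero_add, nsmul_one, zsmul_eq_mul]
        push_cast
        field_simp
        linear_combination (-(m.choose k : ℝ) * P.eval (k : ℝ)) * hs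
    _ = 0 := by rw [hz, mul_zero]

/-- `P_m^{(1,1)}(1 - 2 t)` as a polynomial in `t`. -/
def shiftedJacobi (m : ℕ) : Polynomial ℝ :=
  (jacobiPoly m 1 1).comp (1 - 2 * Polynomial.X)

lemma eval_shiftedJacobi (m : ℕ) (t : ℝ) :
    (shiftedJacobi m).eval t = jacobiR m 1 1 (1 - 2 * t) := by
  simp [shiftedJacobi, jacobiR, Polynomial.eval_comp]

lemma shiftedJacobi_eq (m : ℕ) :
    shiftedJacobi m = Polynomial.C (poch (1 + 1) m / (m.factorial : ℝ)) *
      ∑ k ∈ range (m + 1), Polynomial.C (jacobiCoeff m k) * Polynomial.X ^ k := by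
  refine Polynomial.funext fun t => ?_
  rw [eval_shiftedJacobi]
  simp only [jacobiR, jacobiPoly, jacobiCoeff, Polynomial.eval_mul, Polynomial.eval_C,
    Polynomial.eval_finsetSum, Polynomial.eval_pow, Polynomial.eval_sub, Polynomial.eval_one,
    Polynomial.eval_X]
  congr 1
  refine sum_congr rfl fun k _ => ?_
  congr 2
  ring

lemma natDegree_shiftedJacobi (m : ℕ) : (shiftedJacobi m).natDegree = m := by
  rw [shiftedJacobi_eq]
  refine Polynomial.natDegree_eq_of_le_of_coeff_ne_zero ?_ ?_
  · refine (Polynomial.natDegree_C_mul_le _ _).trans ?_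
    refine Polynomial.natDegree_sum_le_of_forall_le _ _ fun k hk => ?_
    exact (Polynomial.natDegree_C_mul_X_pow_le _ _).trans (by simpa [Nat.lt_succ_iff] using hk)
  · rw [Polynomial.coeff_C_mul, Polynomial.finsetSum_coeff]
    simp only [Polynomial.coeff_C_mul_X_pow]
    rw [sum_ite_eq, if_pos (by simp), jacobiCoeff_eq m m le_rfl, one_add_one_eq_two, poch_two]
    have : ∏ i ∈ range (m + 1), ((m : ℝ) + (i + 2)) ≠ 0 :=
      prod_ne_zero_iff.mpr fun i _ => by positivity
    have f1 : ((m + 1).factorial : ℝ) ≠ 0 := by positivity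
    have f2 : (m.factorial : ℝ) ≠ 0 := by positivity
    have f3 : ((m + 2).factorial : ℝ) ≠ 0 := by positivity
    simp [*]

/-- `G` is orthogonal on `[0, 1]`, with weight `t (1 - t)`, to the polynomials of degree `≤ n`. -/
def OrthUnit (n : ℕ) (G : Polynomial ℝ) : Prop :=
  ∀ p : Polynomial ℝ, p.natDegree ≤ n →
    ∫ t in (0 : ℝ)..1, G.eval t * p.eval t * (t * (1 - t)) = 0

lemma orthUnit_shiftedJacobi (n : ℕ) : OrthUnit n (shiftedJacobi (n + 1)) := by
  have hmono : ∀ j ≤ n, ∫ t in (0 : ℝ)..1,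
      (shiftedJacobi (n + 1)).eval t * t ^ j * (t * (1 - t)) = 0 := by
    intro j hj
    have hexp : ∀ t : ℝ, (shiftedJacobi (n + 1)).eval t * t ^ j * (t * (1 - t))
        = poch (1 + 1) (n + 1) / ((n + 1).factorial : ℝ) * ∑ k ∈ range (n + 1 + 1),
          jacobiCoeff (n + 1) k * (t ^ (k + j + 1) - t ^ (k + j + 2)) := by
      intro t
      rw [shiftedJacobi_eq, Polynomial.eval_mul, Polynomial.eval_C, Polynomial.eval_finsetSum,
        mul_assoc, mul_assoc, sum_mul]
      congr 1
      refine sum_congr rfl fun k _ => ?_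
      simp only [Polynomial.eval_mul, Polynomial.eval_C, Polynomial.eval_pow, Polynomial.eval_X]
      ring
    simp_rw [hexp]
    rw [intervalIntegral.integral_const_mul, intervalIntegral.integral_finsetSum
      fun k _ => (by fun_prop : Continuous _).intervalIntegrable _ _]
    rw [mul_eq_zero]
    right
    refine (sum_congr rfl ?_).trans (sum_jacobiCoeff_div (n + 1) j (by omega))
    intro k _
    rw [intervalIntegral.integral_const_mul, intervalIntegral.integral_sub
      ((by fun_prop : Continuous _).intervalIntegrable _ _)
      ((by fun_prop : Continuous _).intervalIntegrable _ _), integral_pow, integral_pow]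
    have h1 : ((k : ℝ) + (j + 2)) ≠ 0 := by positivity
    have h2 : ((k : ℝ) + (j + 3)) ≠ 0 := by positivity
    have h3 : ((k : ℝ) + j + 1 + 1) ≠ 0 := by positivity
    have h4 : ((k : ℝ) + j + 2 + 1) ≠ 0 := by positivity
    push_cast
    rw [div_eq_mul_inv]
    congr 1
    simp only [one_pow, zero_pow (Nat.succ_ne_zero _)]
    field_simp
    ring
  intro p hp
  have hexp : ∀ t : ℝ, (shiftedJacobi (n + 1)).eval t * p.eval t * (t * (1 - t))
      = ∑ j ∈ range (n + 1),
        p.coeff j * ((shiftedJacobi (n + 1)).eval t * t ^ j * (t * (1 - t))) := by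
    intro t
    rw [Polynomial.eval_eq_sum_range' (Nat.lt_succ_of_le hp) t, mul_sum, sum_mul]
    exact sum_congr rfl fun j _ => by ring
  simp_rw [hexp]
  rw [intervalIntegral.integral_finsetSum
    fun k _ => (by fun_prop : Continuous _).intervalIntegrable _ _]
  refine sum_eq_zero fun j hj => ?_
  rw [intervalIntegral.integral_const_mul, hmono j (by simpa [Nat.lt_succ_iff] using hj), mul_zero]

lemma OrthUnit.comp_one_sub {n : ℕ} {G : Polynomial ℝ} (hG : OrthUnit n G) :
    OrthUnit n (G.comp (1 - Polynomial.X)) := by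
  intro p hp
  have hdeg : (p.comp (1 - Polynomial.X)).natDegree ≤ n := by
    refine Polynomial.natDegree_comp_le.trans ?_
    have : (1 - Polynomial.X : Polynomial ℝ).natDegree ≤ 1 :=
      (Polynomial.natDegree_sub_le _ _).trans (by simp)
    nlinarith
  have h := hG _ hdeg
  have h' := intervalIntegral.integral_comp_sub_left (a := 0) (b := 1)
    (fun t : ℝ => G.eval t * (p.comp (1 - Polynomial.X)).eval t * (t * (1 - t))) 1
  simp only [sub_self, sub_zero] at h'
  refine Eq.trans ?_ (h'.trans h)
  refine intervalIntegral.integral_congr fun t _ => ?_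
  simp only [Polynomial.eval_comp, Polynomial.eval_sub, Polynomial.eval_one, Polynomial.eval_X,
    sub_sub_cancel]
  ring

lemma continuous_evalP (u : MvPolynomial (Fin 2) ℝ) : Continuous (evalP u) :=
  (MvPolynomial.continuous_eval u).comp (by fun_prop)

lemma evalP_eq_sum (u : MvPolynomial (Fin 2) ℝ) (p : ℝ × ℝ) :
    evalP u p = ∑ d ∈ u.support, u.coeff d * (p.1 ^ d 0 * p.2 ^ d 1) := by
  simp [evalP, MvPolynomial.eval_eq', Fin.prod_univ_two]

lemma evalP_aeval (u f g : MvPolynomial (Fin 2) ℝ) (p : ℝ × ℝ) :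
    evalP (MvPolynomial.aeval ![f, g] u) p = evalP u (evalP f p, evalP g p) := by
  rw [evalP_eq_sum u, MvPolynomial.aeval_def, MvPolynomial.eval₂_eq']
  simp [evalP, Fin.prod_univ_two]

lemma totalDegree_aeval_le_of_le_one {σ τ R : Type*} [CommSemiring R] (u : MvPolynomial σ R)
    (f : σ → MvPolynomial τ R) (hf : ∀ i, (f i).totalDegree ≤ 1) :
    (MvPolynomial.aeval f u).totalDegree ≤ u.totalDegree := by
  rw [MvPolynomial.aeval_def, MvPolynomial.eval₂_eq]
  refine MvPolynomial.totalDegree_finsetSum_le fun d hd => ?_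
  rw [MvPolynomial.algebraMap_eq]
  refine (MvPolynomial.totalDegree_mul _ _).trans ?_
  rw [MvPolynomial.totalDegree_C, zero_add]
  refine (MvPolynomial.totalDegree_finsetProd _ _).trans ?_
  refine le_trans (sum_le_sum fun i _ => ?_) (MvPolynomial.le_totalDegree hd)
  exact (MvPolynomial.totalDegree_pow _ _).trans (by nlinarith [hf i])

/-- The closed unit triangle. -/
def closedTri : Set (ℝ × ℝ) := {p | 0 ≤ p.1 ∧ 0 ≤ p.2 ∧ p.1 + p.2 ≤ 1}

lemma mem_closedTri (p : ℝ × ℝ) : p ∈ closedTri ↔ 0 ≤ p.1 ∧ 0 ≤ p.2 ∧ p.1 + p.2 ≤ 1 := Iff.rfl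

lemma isCompact_closedTri : IsCompact closedTri := by
  refine (isCompact_Icc (a := ((0 : ℝ), (0 : ℝ))) (b := (1, 1))).of_isClosed_subset ?_ ?_
  · exact (isClosed_le continuous_const continuous_fst).inter
      ((isClosed_le continuous_const continuous_snd).inter
        (isClosed_le (continuous_fst.add continuous_snd) continuous_const))
  · rintro ⟨x, y⟩ ⟨h1, h2, h3⟩
    simp only at h1 h2 h3
    refine ⟨⟨h1, h2⟩, ⟨?_, ?_⟩⟩ <;> simp only <;> linarith

lemma convexHull_unit_triangle :
    convexHull ℝ {((0 : ℝ), (0 : ℝ)), (1, 0), (0, 1)} = closedTri := by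
  apply Set.Subset.antisymm
  · refine convexHull_min ?_ ?_
    · rintro p (rfl | rfl | rfl) <;> norm_num [closedTri]
    · rintro ⟨x, y⟩ ⟨h1, h2, h3⟩ ⟨x', y'⟩ ⟨h1', h2', h3'⟩ a b ha hb hab
      simp only at h1 h2 h3 h1' h2' h3'
      simp only [mem_closedTri, Prod.smul_mk, Prod.mk_add_mk, smul_eq_mul]
      exact ⟨by positivity, by positivity, by nlinarith⟩
  · rintro ⟨x, y⟩ ⟨h1, h2, h3⟩
    simp only at h1 h2 h3
    have h := (convex_convexHull ℝ {((0 : ℝ), (0 : ℝ)), (1, 0), (0, 1)}).sum_mem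
      (t := Finset.univ) (w := ![1 - x - y, x, y])
      (z := ![((0 : ℝ), (0 : ℝ)), (1, 0), (0, 1)])
      (by intro i _; fin_cases i <;> simp <;> linarith)
      (by simp [Fin.sum_univ_three]; ring)
      (by intro i _; apply subset_convexHull; fin_cases i <;> simp)
    simpa [Fin.sum_univ_three] using h

lemma tri_ae_eq_convexHull (A B C : ℝ × ℝ) :
    tri A B C =ᵐ[volume] (convexHull ℝ {A, B, C} : Set (ℝ × ℝ)) :=
  interior_ae_eq_of_null_frontier ((convex_convexHull ℝ _).addHaar_frontier volume)

lemma setIntegral_unit_triangle (f : ℝ × ℝ → ℝ) :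
    ∫ p in tri (0, 0) (1, 0) (0, 1), f p = ∫ p in closedTri, f p := by
  rw [setIntegral_congr_set (tri_ae_eq_convexHull _ _ _), convexHull_unit_triangle]

lemma setIntegral_comp_involutive {φ : ℝ × ℝ → ℝ × ℝ} (hφ : MeasurePreserving φ)
    (hc : Continuous φ) (hi : Function.Involutive φ) (f : ℝ × ℝ → ℝ) (s : Set (ℝ × ℝ)) :
    ∫ p in φ ⁻¹' s, f (φ p) = ∫ p in s, f p :=
  hφ.setIntegral_preimage_emb
    (Homeomorph.measurableEmbedding
      { toEquiv := hi.toPerm, continuous_toFun := hc, continuous_invFun := hc }) f s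

lemma measurePreserving_of_snd {f : ℝ → ℝ} (hf : MeasurePreserving f) {g : ℝ → ℝ → ℝ}
    (hgm : Measurable (Function.uncurry g)) (hg : ∀ y, MeasurePreserving (g y)) :
    MeasurePreserving (fun p : ℝ × ℝ => (g p.2 p.1, f p.2)) :=
  (Measure.measurePreserving_swap.comp
    (hf.skew_product hgm (Filter.Eventually.of_forall fun y => (hg y).map_eq))).comp
      Measure.measurePreserving_swap

/-- The affine involution exchanging the vertices `(0, 0)` and `(1, 0)` of the unit triangle. -/
def reflTri (p : ℝ × ℝ) : ℝ × ℝ := (1 - p.1 - p.2, p.2)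

/-- The linear involution mapping the unit triangle to the triangle
`(1, 0)`, `(0, 0)`, `(1, -1)`. -/
def shearTri (p : ℝ × ℝ) : ℝ × ℝ := (p.1 + p.2, -p.2)

lemma measurePreserving_reflTri : MeasurePreserving reflTri := by
  refine measurePreserving_of_snd (MeasurePreserving.id _) (g := fun y x => 1 - x - y)
    (by fun_prop) fun y => ?_
  simp_rw [sub_right_comm (1 : ℝ) _ y]
  exact Measure.measurePreserving_sub_left volume (1 - y)

lemma measurePreserving_shearTri : MeasurePreserving shearTri :=
  measurePreserving_of_snd (Measure.measurePreserving_neg _) (g := fun y x => x + y)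
    (by fun_prop) fun y => measurePreserving_add_right _ y

lemma setIntegral_reflTri (f : ℝ × ℝ → ℝ) :
    ∫ p in closedTri, f (reflTri p) = ∫ p in closedTri, f p := by
  rw [← setIntegral_comp_involutive measurePreserving_reflTri
    (by unfold reflTri; fun_prop) (fun p => by ext <;> simp [reflTri]; ring) f closedTri]
  congr 2
  ext p
  simp only [Set.mem_preimage, mem_closedTri, reflTri]
  constructor <;> rintro ⟨h1, h2, h3⟩ <;> exact ⟨by linarith, by linarith, by linarith⟩

lemma setIntegral_shearTri (f : ℝ × ℝ → ℝ) :
    ∫ p in tri (1, 0) (0, 0) (1, -1), f p = ∫ p in closedTri, f (shearTri p) := by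
  have hi : Function.Involutive shearTri := fun p => by ext <;> simp [shearTri]
  rw [setIntegral_congr_set (tri_ae_eq_convexHull _ _ _),
    ← setIntegral_comp_involutive measurePreserving_shearTri (by unfold shearTri; fun_prop) hi]
  congr 2
  rw [← hi.image_eq_preimage_symm, IsLinearMap.image_convexHull (𝕜 := ℝ), ← convexHull_unit_triangle]
  · simp [Set.image_insert_eq, shearTri, Set.insert_comm]
  · constructor
    · intro p q
      ext <;> simp [shearTri] <;> ring
    · intro c p
      ext <;> simp [shearTri]; ring

lemma integral_pow_mul_sub (b : ℕ) (c : ℝ) :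
    ∫ y in (0 : ℝ)..c, y ^ b * (c - y) = c ^ (b + 2) / ((b + 1) * (b + 2)) := by
  have h : ∀ y : ℝ, y ^ b * (c - y) = c * y ^ b - y ^ (b + 1) := fun y => by ring
  simp_rw [h]
  rw [intervalIntegral.integral_sub ((by fun_prop : Continuous _).intervalIntegrable _ _)
    ((by fun_prop : Continuous _).intervalIntegrable _ _), intervalIntegral.integral_const_mul,
    integral_pow, integral_pow]
  have h1 : (b : ℝ) + 1 ≠ 0 := by positivity
  have h2 : (b : ℝ) + 2 ≠ 0 := by positivity
  have h3 : (b : ℝ) + 1 + 1 ≠ 0 := by positivity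
  push_cast
  simp only [zero_pow (Nat.succ_ne_zero _)]
  field_simp
  ring

lemma OrthUnit.setIntegral_monomial {n : ℕ} {G : Polynomial ℝ} (hG : OrthUnit n G) (a b : ℕ)
    (hab : a + b + 1 ≤ n) :
    ∫ p in closedTri, G.eval p.1 * (p.1 ^ a * p.2 ^ b) * (p.1 * (1 - p.1 - p.2)) = 0 := by
  have hm : MeasurableSet closedTri := isCompact_closedTri.isClosed.measurableSet
  have hint : IntegrableOn
      (fun p : ℝ × ℝ => G.eval p.1 * (p.1 ^ a * p.2 ^ b) * (p.1 * (1 - p.1 - p.2))) closedTri :=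
    ContinuousOn.integrableOn_compact isCompact_closedTri
      (by fun_prop : Continuous _).continuousOn
  rw [← integral_indicator hm, Measure.volume_eq_prod,
    integral_prod _ ((integrable_indicator_iff hm).mpr hint)]
  have hinner : ∀ x : ℝ, (∫ y, closedTri.indicator
      (fun p : ℝ × ℝ => G.eval p.1 * (p.1 ^ a * p.2 ^ b) * (p.1 * (1 - p.1 - p.2))) (x, y))
      = (Set.Icc 0 1).indicator (fun x => ((b + 1 : ℝ) * (b + 2))⁻¹ *
        (G.eval x * (Polynomial.X ^ a * (1 - Polynomial.X) ^ (b + 1) : Polynomial ℝ).eval x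
          * (x * (1 - x)))) x := by
    intro x
    by_cases hx : x ∈ Set.Icc (0 : ℝ) 1
    · have hy : ∀ y, closedTri.indicator (fun p : ℝ × ℝ =>
          G.eval p.1 * (p.1 ^ a * p.2 ^ b) * (p.1 * (1 - p.1 - p.2))) (x, y)
          = (Set.Icc 0 (1 - x)).indicator
            (fun y => G.eval x * x ^ (a + 1) * (y ^ b * (1 - x - y))) y := by
        intro y
        have hiff : (x, y) ∈ closedTri ↔ y ∈ Set.Icc 0 (1 - x) := by
          rw [mem_closedTri, Set.mem_Icc]
          exact ⟨fun h => ⟨h.2.1, by linarith [h.2.2]⟩,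
            fun h => ⟨hx.1, h.1, by linarith [h.2]⟩⟩
        by_cases h : y ∈ Set.Icc 0 (1 - x)
        · rw [Set.indicator_of_mem h, Set.indicator_of_mem (hiff.mpr h)]
          ring
        · rw [Set.indicator_of_notMem h, Set.indicator_of_notMem (mt hiff.mp h)]
      simp_rw [hy]
      rw [integral_indicator measurableSet_Icc, integral_Icc_eq_integral_Ioc,
        ← intervalIntegral.integral_of_le (by linarith [hx.2]),
        intervalIntegral.integral_const_mul, integral_pow_mul_sub, Set.indicator_of_mem hx]
      simp only [Polynomial.eval_mul, Polynomial.eval_pow, Polynomial.eval_sub,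
        Polynomial.eval_one, Polynomial.eval_X]
      ring
    · rw [Set.indicator_of_notMem hx]
      refine integral_eq_zero_of_ae (Filter.Eventually.of_forall fun y => ?_)
      refine Set.indicator_of_notMem (fun h => hx ⟨h.1, ?_⟩) _
      have h2 := h.2.1
      have h3 := h.2.2
      simp only at h2 h3
      linarith
  simp_rw [hinner]
  rw [integral_indicator measurableSet_Icc, integral_Icc_eq_integral_Ioc,
    ← intervalIntegral.integral_of_le zero_le_one, intervalIntegral.integral_const_mul, hG,
    mul_zero]
  refine Polynomial.natDegree_mul_le.trans ?_
  have h1 : (1 - Polynomial.X : Polynomial ℝ).natDegree ≤ 1 :=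
    (Polynomial.natDegree_sub_le _ _).trans (by simp)
  have h2 := Polynomial.natDegree_pow_le_of_le (b + 1) h1
  rw [Polynomial.natDegree_X_pow]
  omega

lemma OrthUnit.setIntegral_evalP {n : ℕ} {G : Polynomial ℝ} (hG : OrthUnit n G)
    (r : MvPolynomial (Fin 2) ℝ) (hr : r.totalDegree + 1 ≤ n) :
    ∫ p in closedTri, G.eval p.1 * evalP r p * (p.1 * (1 - p.1 - p.2)) = 0 := by
  have hexp : ∀ p : ℝ × ℝ, G.eval p.1 * evalP r p * (p.1 * (1 - p.1 - p.2))
      = ∑ d ∈ r.support, r.coeff d *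
        (G.eval p.1 * (p.1 ^ d 0 * p.2 ^ d 1) * (p.1 * (1 - p.1 - p.2))) := by
    intro p
    rw [evalP_eq_sum, mul_sum, sum_mul]
    exact sum_congr rfl fun d _ => by ring
  simp_rw [hexp]
  rw [integral_finsetSum _ fun d _ => ContinuousOn.integrableOn_compact isCompact_closedTri
    (by fun_prop : Continuous _).continuousOn]
  refine sum_eq_zero fun d hd => ?_
  have hdeg := MvPolynomial.le_totalDegree hd
  rw [Finsupp.sum_fintype _ _ (fun _ => rfl), Fin.sum_univ_two] at hdeg
  rw [integral_const_mul, hG.setIntegral_monomial _ _ (by omega), mul_zero]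

/-- The divided difference `(F(x + y) - F(x)) / y` as a bivariate polynomial. -/
def divDiff (F : Polynomial ℝ) : MvPolynomial (Fin 2) ℝ :=
  ∑ k ∈ range (F.natDegree + 1), MvPolynomial.C (F.coeff k) *
    ∑ i ∈ range k, (MvPolynomial.X 0 + MvPolynomial.X 1) ^ i * MvPolynomial.X 0 ^ (k - 1 - i)

lemma evalP_divDiff_mul (F : Polynomial ℝ) (p : ℝ × ℝ) :
    evalP (divDiff F) p * p.2 = F.eval (p.1 + p.2) - F.eval p.1 := by
  rw [Polynomial.eval_eq_sum_range, Polynomial.eval_eq_sum_range, ← sum_sub_distrib]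
  simp only [evalP, divDiff, map_sum, map_mul, map_pow, map_add, MvPolynomial.eval_C,
    MvPolynomial.eval_X, Matrix.cons_val_zero, Matrix.cons_val_one]
  rw [sum_mul]
  refine sum_congr rfl fun k _ => ?_
  have h := (Commute.all (p.1 + p.2) p.1).geom_sum₂_mul k
  rw [add_sub_cancel_left] at h
  rw [mul_assoc, h, mul_sub]

lemma evalP_divDiff_shear (F : Polynomial ℝ) (x y : ℝ) :
    evalP (divDiff F) (x + y, -y) = evalP (divDiff F) (x, y) := by
  by_cases hy : y = 0
  · simp [hy]
  · have h1 := evalP_divDiff_mul F (x + y, -y)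
    have h2 := evalP_divDiff_mul F (x, y)
    simp only [add_neg_cancel_right] at h1 h2
    exact mul_right_cancel₀ hy (by linarith)

lemma totalDegree_divDiff (F : Polynomial ℝ) (n : ℕ) (hF : F.natDegree = n + 1) :
    (divDiff F).totalDegree = n := by
  apply le_antisymm
  · refine MvPolynomial.totalDegree_finsetSum_le fun k hk => ?_
    refine (MvPolynomial.totalDegree_mul _ _).trans ?_
    rw [MvPolynomial.totalDegree_C, zero_add]
    refine MvPolynomial.totalDegree_finsetSum_le fun i hi => ?_
    refine (MvPolynomial.totalDegree_mul _ _).trans ?_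
    rw [mem_range] at hk hi
    have hX : (MvPolynomial.X 0 + MvPolynomial.X 1 : MvPolynomial (Fin 2) ℝ).totalDegree ≤ 1 :=
      (MvPolynomial.totalDegree_add _ _).trans (by simp)
    have h1 : ((MvPolynomial.X 0 + MvPolynomial.X 1 : MvPolynomial (Fin 2) ℝ) ^ i).totalDegree
        ≤ i := (MvPolynomial.totalDegree_pow _ _).trans (by nlinarith)
    rw [MvPolynomial.totalDegree_X_pow]
    omega
  · have h := MvPolynomial.aeval_natDegree_le (n := 1) (divDiff F) le_rfl
      ![(Polynomial.X : Polynomial ℝ), 0] (by intro i; fin_cases i <;> simp)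
    have hder : MvPolynomial.aeval ![(Polynomial.X : Polynomial ℝ), 0] (divDiff F)
        = Polynomial.derivative F := by
      conv_rhs => rw [F.as_sum_range_C_mul_X_pow]
      rw [Polynomial.derivative_sum]
      simp only [divDiff, map_sum, map_mul, map_pow, map_add, MvPolynomial.aeval_X,
        MvPolynomial.aeval_C, Matrix.cons_val_zero, Matrix.cons_val_one, add_zero]
      refine sum_congr rfl fun k _ => ?_
      rw [Polynomial.derivative_C_mul_X_pow, geom_sum₂_self, Polynomial.algebraMap_eq, map_mul,
        mul_assoc]
      simp
    rw [hder, Polynomial.natDegree_derivative] at h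
    omega

lemma setIntegral_divDiff_eq_zero {n : ℕ} {F : Polynomial ℝ} (hF : OrthUnit n F)
    (r : MvPolynomial (Fin 2) ℝ) (hr : r.totalDegree + 1 ≤ n) :
    ∫ p in closedTri, evalP (divDiff F) p * evalP r p * (p.1 * p.2 * (1 - p.1 - p.2)) = 0 := by
  set r' : MvPolynomial (Fin 2) ℝ :=
    MvPolynomial.aeval ![1 - MvPolynomial.X 0 - MvPolynomial.X 1, MvPolynomial.X 1] r with hr'
  have hdeg : r'.totalDegree + 1 ≤ n := by
    refine le_trans (Nat.succ_le_succ (totalDegree_aeval_le_of_le_one r _ fun i => ?_)) hr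
    fin_cases i
    · refine (MvPolynomial.totalDegree_sub _ _).trans (max_le ?_ (by simp))
      exact (MvPolynomial.totalDegree_sub _ _).trans (by simp)
    · simp
  have hrefl := setIntegral_reflTri fun p =>
    F.eval (p.1 + p.2) * evalP r p * (p.1 * (1 - p.1 - p.2))
  have h0 : ∫ p in closedTri, F.eval (p.1 + p.2) * evalP r p * (p.1 * (1 - p.1 - p.2)) = 0 := by
    refine Eq.trans (hrefl.symm.trans ?_) (hF.comp_one_sub.setIntegral_evalP r' hdeg)
    congr 1 with p
    rw [hr', evalP_aeval]
    simp only [evalP, reflTri, Polynomial.eval_comp, Polynomial.eval_sub, Polynomial.eval_one,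
      Polynomial.eval_X, map_sub, map_one, MvPolynomial.eval_X, Matrix.cons_val_zero,
      Matrix.cons_val_one, sub_add_cancel]
    ring
  have hcr := continuous_evalP r
  have hsplit : ∀ p : ℝ × ℝ, evalP (divDiff F) p * evalP r p * (p.1 * p.2 * (1 - p.1 - p.2))
      = F.eval (p.1 + p.2) * evalP r p * (p.1 * (1 - p.1 - p.2))
        - F.eval p.1 * evalP r p * (p.1 * (1 - p.1 - p.2)) := by
    intro p
    linear_combination (evalP r p * (p.1 * (1 - p.1 - p.2))) * evalP_divDiff_mul F p
  simp_rw [hsplit]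
  have hint : ∀ f : ℝ × ℝ → ℝ, Continuous f → IntegrableOn f closedTri := fun f hf =>
    hf.continuousOn.integrableOn_compact isCompact_closedTri
  rw [integral_sub (hint _ (by fun_prop)) (hint _ (by fun_prop)), h0, hF.setIntegral_evalP r hr,
    sub_zero]

lemma bubble_unit_triangle (p : ℝ × ℝ) :
    bubble (0, 0) (1, 0) (0, 1) p = p.1 * p.2 * (1 - p.1 - p.2) := by
  simp [bubble, bary, det2]
  ring

lemma bubble_shearTri (p : ℝ × ℝ) :
    bubble (1, 0) (0, 0) (1, -1) (shearTri p) = p.1 * p.2 * (1 - p.1 - p.2) := by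
  simp [bubble, bary, det2, shearTri]
  ring

/-- For `n ≥ 1` let `q_n(x,y) = (P_{n+1}^{(1,1)}(1-2(x+y)) -
P_{n+1}^{(1,1)}(1-2x))/y`.  Then (i) `q_n` is a bivariate polynomial of total degree `n`;
(ii) `q_n(x+y,-y) = q_n(x,y)`; (iii) `∫∫_{T₁} q_n r · xy(1-x-y) dx dy = 0` for every
bivariate polynomial `r` of total degree at most `n-1`.  Consequently
`q_n ∈ P_{n-1}^⊥(T₁) ∩ P_{n-1}^⊥(K_{1,0})`, where `K_{1,0} = conv°((1,0),(0,0),(1,-1))`. -/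
theorem statement9 (n : ℕ) (hn : 1 ≤ n) :
    ∃ qn : MvPolynomial (Fin 2) ℝ,
      (∀ p : ℝ × ℝ, evalP qn p * p.2 =
        jacobiR (n + 1) 1 1 (1 - 2 * (p.1 + p.2)) - jacobiR (n + 1) 1 1 (1 - 2 * p.1)) ∧
      qn.totalDegree = n ∧
      (∀ x y : ℝ, evalP qn (x + y, -y) = evalP qn (x, y)) ∧
      (∀ r : MvPolynomial (Fin 2) ℝ, r.totalDegree ≤ n - 1 →
        (∫ p in tri (0, 0) (1, 0) (0, 1),
          evalP qn p * evalP r p * (p.1 * p.2 * (1 - p.1 - p.2))) = 0) ∧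
      inPerp n (0, 0) (1, 0) (0, 1) qn ∧ inPerp n (1, 0) (0, 0) (1, -1) qn := by
  have hF := orthUnit_shiftedJacobi n
  have hdeg : (divDiff (shiftedJacobi (n + 1))).totalDegree = n :=
    totalDegree_divDiff _ n (natDegree_shiftedJacobi (n + 1))
  refine ⟨divDiff (shiftedJacobi (n + 1)), fun p => ?_, hdeg, evalP_divDiff_shear _, fun r hr => ?_,
    ⟨hdeg.le, fun w hw => ?_⟩, ⟨hdeg.le, fun w hw => ?_⟩⟩
  · rw [evalP_divDiff_mul, eval_shiftedJacobi, eval_shiftedJacobi]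
  · rw [setIntegral_unit_triangle]
    exact setIntegral_divDiff_eq_zero hF r (by omega)
  · simp_rw [innerT, bubble_unit_triangle]
    rw [setIntegral_unit_triangle]
    exact setIntegral_divDiff_eq_zero hF w (by omega)
  · set w' : MvPolynomial (Fin 2) ℝ :=
      MvPolynomial.aeval ![MvPolynomial.X 0 + MvPolynomial.X 1, -MvPolynomial.X 1] w with hw'
    have hdeg' : w'.totalDegree ≤ w.totalDegree := by
      refine totalDegree_aeval_le_of_le_one w _ fun i => ?_
      fin_cases i
      · exact (MvPolynomial.totalDegree_add _ _).trans (by simp)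
      · simp
    rw [innerT, setIntegral_shearTri]
    refine Eq.trans ?_ (setIntegral_divDiff_eq_zero hF w' (by omega))
    congr 1 with p
    rw [bubble_shearTri, hw', evalP_aeval, shearTri, evalP_divDiff_shear]
    simp [evalP]
end
end

section
/- Let n > 1, let K_1 = conv°(A,B,C) and K_2 = conv°(B,A,D) be two disjoint open triangles with common edge AB (vertices of each triangle listed counterclockwise). Then the dimension of P_{n−1}^⊥(K_1) ∩ P_{n−1}^⊥(K_2) equals 1 if D belongs to the total critical set L_crit^{n,tot}(K_1, C), and equals 0 otherwise. -/
open MeasureTheory Finset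

noncomputable section

/-- The critical half-line `L_crit(T,V,W) = {V + t(W - V) : t ≥ 1}`. -/
def Lcrit (V W : ℝ × ℝ) : Set (ℝ × ℝ) := {X | ∃ t : ℝ, 1 ≤ t ∧ X = V + t • (W - V)}

/-- The critical point `Q_crit(T,V) = P + Q - V`, where `P, Q` are the other two
vertices of the triangle. -/
def Qcrit (V P Q : ℝ × ℝ) : ℝ × ℝ := P + Q - V

/-- The critical line `L²_crit(T,V) = {2P - V + t(Q - P) : t ∈ ℝ}`, where `P, Q` are
the other two vertices of the triangle. -/
def L2crit (V P Q : ℝ × ℝ) : Set (ℝ × ℝ) :=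
  {X | ∃ t : ℝ, X = (2 : ℝ) • P - V + t • (Q - P)}

/-- The total critical set `L_crit^{n,tot}(T,V)` of a triangle with distinguished vertex
`V` and remaining vertices `P, Q`. -/
def LcritTot (n : ℕ) (V P Q : ℝ × ℝ) : Set (ℝ × ℝ) :=
  if n = 2 then Lcrit V P ∪ Lcrit V Q ∪ L2crit V P Q
  else Lcrit V P ∪ Lcrit V Q ∪ {Qcrit V P Q}

/-- The coefficient of `x ^ i * y ^ j` in a bivariate polynomial. -/
def cf (u : MvPolynomial (Fin 2) ℝ) (i j : ℕ) : ℝ :=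
  u.coeff (Finsupp.single 0 i + Finsupp.single 1 j)

lemma exists_eq_single_add_single (m : Fin 2 →₀ ℕ) :
    m = Finsupp.single 0 (m 0) + Finsupp.single 1 (m 1) := by
  ext k
  fin_cases k <;> simp

lemma ext_cf {u v : MvPolynomial (Fin 2) ℝ} (h : ∀ i j, cf u i j = cf v i j) : u = v := by
  ext m
  rw [exists_eq_single_add_single m]
  exact h _ _

lemma totalDegree_le_iff_cf {u : MvPolynomial (Fin 2) ℝ} {n : ℕ} :
    u.totalDegree ≤ n ↔ ∀ i j, n < i + j → cf u i j = 0 := by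
  constructor
  · intro h i j hij
    by_contra hne
    have := MvPolynomial.le_totalDegree (MvPolynomial.mem_support_iff.2 hne)
    rw [Finsupp.sum_fintype _ _ (by simp)] at this
    simp at this
    omega
  · intro h
    refine Finset.sup_le fun m hm => ?_
    by_contra hlt
    rw [MvPolynomial.mem_support_iff, exists_eq_single_add_single m] at hm
    refine hm (h _ _ ?_)
    rw [Finsupp.sum_fintype _ _ (by simp)] at hlt
    simpa using hlt

@[simp] lemma cf_add (u v : MvPolynomial (Fin 2) ℝ) (i j : ℕ) :
    cf (u + v) i j = cf u i j + cf v i j := MvPolynomial.coeff_add _ _ _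

@[simp] lemma cf_sub (u v : MvPolynomial (Fin 2) ℝ) (i j : ℕ) :
    cf (u - v) i j = cf u i j - cf v i j := MvPolynomial.coeff_sub _ _ _ _

@[simp] lemma cf_C_mul (a : ℝ) (u : MvPolynomial (Fin 2) ℝ) (i j : ℕ) :
    cf (MvPolynomial.C a * u) i j = a * cf u i j := MvPolynomial.coeff_C_mul _ _ _

@[simp] lemma cf_smul (a : ℝ) (u : MvPolynomial (Fin 2) ℝ) (i j : ℕ) :
    cf (a • u) i j = a * cf u i j := MvPolynomial.coeff_smul _ _ _

@[simp] lemma cf_zero (i j : ℕ) : cf 0 i j = 0 := MvPolynomial.coeff_zero _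

@[simp] lemma cf_pderiv_zero (u : MvPolynomial (Fin 2) ℝ) (i j : ℕ) :
    cf (MvPolynomial.pderiv 0 u) i j = (i + 1) * cf u (i + 1) j := by
  simp only [cf, MvPolynomial.coeff_pderiv, Finsupp.single_add]
  rw [mul_comm, add_right_comm]
  simp

@[simp] lemma cf_pderiv_one (u : MvPolynomial (Fin 2) ℝ) (i j : ℕ) :
    cf (MvPolynomial.pderiv 1 u) i j = (j + 1) * cf u i (j + 1) := by
  simp only [cf, MvPolynomial.coeff_pderiv, Finsupp.single_add]
  rw [mul_comm, add_assoc]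
  simp

lemma cf_X_zero_mul_zero (u : MvPolynomial (Fin 2) ℝ) (j : ℕ) :
    cf (MvPolynomial.X 0 * u) 0 j = 0 := by
  simp [cf, MvPolynomial.coeff_X_mul']

lemma cf_X_zero_mul_succ (u : MvPolynomial (Fin 2) ℝ) (i j : ℕ) :
    cf (MvPolynomial.X 0 * u) (i + 1) j = cf u i j := by
  rw [cf, Finsupp.single_add, add_comm (Finsupp.single 0 i), add_assoc, MvPolynomial.coeff_X_mul,
    cf]

@[simp] lemma cf_X_one_mul_zero (u : MvPolynomial (Fin 2) ℝ) (i : ℕ) :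
    cf (MvPolynomial.X 1 * u) i 0 = 0 := by
  simp [cf, MvPolynomial.coeff_X_mul']

@[simp] lemma cf_X_one_mul_succ (u : MvPolynomial (Fin 2) ℝ) (i j : ℕ) :
    cf (MvPolynomial.X 1 * u) i (j + 1) = cf u i j := by
  rw [cf, Finsupp.single_add, add_left_comm, add_comm _ (Finsupp.single 1 1), add_left_comm,
    MvPolynomial.coeff_X_mul, cf, add_comm]

/-- The Euler operator `x ∂ₓ + y ∂ᵧ`. -/
def euler (u : MvPolynomial (Fin 2) ℝ) : MvPolynomial (Fin 2) ℝ :=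
  MvPolynomial.X 0 * MvPolynomial.pderiv 0 u + MvPolynomial.X 1 * MvPolynomial.pderiv 1 u

lemma cf_euler (u : MvPolynomial (Fin 2) ℝ) (i j : ℕ) :
    cf (euler u) i j = (i + j) * cf u i j := by
  rcases i with _ | i <;> rcases j with _ | j <;>
    simp [euler, cf_X_zero_mul_zero, cf_X_zero_mul_succ, add_mul]

/-- The Jacobi differential operator on the reference triangle for the weight `x y (1 - x - y)`. -/
def jacobi (u : MvPolynomial (Fin 2) ℝ) : MvPolynomial (Fin 2) ℝ :=
  MvPolynomial.pderiv 0 (MvPolynomial.pderiv 0 (MvPolynomial.X 0 * u)) +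
    MvPolynomial.pderiv 1 (MvPolynomial.pderiv 1 (MvPolynomial.X 1 * u)) -
    (euler (euler u) + MvPolynomial.C 5 * euler u)

lemma cf_jacobi (u : MvPolynomial (Fin 2) ℝ) (i j : ℕ) :
    cf (jacobi u) i j = (i + 1) * (i + 2) * cf u (i + 1) j + (j + 1) * (j + 2) * cf u i (j + 1)
      - (i + j) * (i + j + 5) * cf u i j := by
  simp only [jacobi, cf_add, cf_sub, cf_pderiv_zero, cf_pderiv_one, cf_X_zero_mul_succ,
    cf_X_one_mul_succ, cf_euler, cf_C_mul]
  push_cast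
  ring

/-- The second order operator measuring the discrepancy between the Jacobi operators of the
reference triangle and of the triangle with vertices `0`, `(1, 0)`, `(a, -b)`. -/
def discrepancy (a b : ℝ) (u : MvPolynomial (Fin 2) ℝ) : MvPolynomial (Fin 2) ℝ :=
  MvPolynomial.C (b * (1 + b)) *
      MvPolynomial.pderiv 1 (MvPolynomial.pderiv 1 (MvPolynomial.X 1 * u)) -
    MvPolynomial.C (2 * a * b) *
      MvPolynomial.pderiv 0 (MvPolynomial.pderiv 1 (MvPolynomial.X 1 * u)) +
    MvPolynomial.C (a * (a - 1)) *
      MvPolynomial.pderiv 0 (MvPolynomial.pderiv 0 (MvPolynomial.X 1 * u))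

lemma cf_discrepancy_zero (a b : ℝ) (u : MvPolynomial (Fin 2) ℝ) (i : ℕ) :
    cf (discrepancy a b u) i 0 =
      b * (1 + b) * 2 * cf u i 1 - 2 * a * b * (i + 1) * cf u (i + 1) 0 := by
  have h : cf (MvPolynomial.X 1 * u) i 2 = cf u i 1 := cf_X_one_mul_succ u i 1
  simp only [discrepancy, cf_add, cf_sub, cf_pderiv_zero, cf_pderiv_one, cf_X_one_mul_zero,
    cf_X_one_mul_succ, cf_C_mul]
  push_cast
  ring

lemma cf_discrepancy_succ (a b : ℝ) (u : MvPolynomial (Fin 2) ℝ) (i j : ℕ) :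
    cf (discrepancy a b u) i (j + 1) =
      b * (1 + b) * (j + 2) * (j + 3) * cf u i (j + 2) -
        2 * a * b * (i + 1) * (j + 2) * cf u (i + 1) (j + 1) +
        a * (a - 1) * (i + 1) * (i + 2) * cf u (i + 2) j := by
  simp only [discrepancy, cf_add, cf_sub, cf_pderiv_zero, cf_pderiv_one, cf_X_one_mul_succ,
    cf_C_mul]
  push_cast
  ring

lemma pderiv_one_pderiv_zero (u : MvPolynomial (Fin 2) ℝ) :
    MvPolynomial.pderiv 1 (MvPolynomial.pderiv 0 u) =
      MvPolynomial.pderiv 0 (MvPolynomial.pderiv 1 u) :=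
  ext_cf fun i j => by simp; ring

lemma exists_cf_eq (n : ℕ) (c : ℕ → ℕ → ℝ) (hc : ∀ i j, n < i + j → c i j = 0) :
    ∃ u : MvPolynomial (Fin 2) ℝ, ∀ i j, cf u i j = c i j := by
  refine ⟨∑ k ∈ range (n + 1), ∑ l ∈ range (n + 1),
    MvPolynomial.monomial (Finsupp.single 0 k + Finsupp.single 1 l) (c k l), fun i j => ?_⟩
  have key : ∀ k l : ℕ, ((Finsupp.single 0 k + Finsupp.single 1 l : Fin 2 →₀ ℕ) =
      Finsupp.single 0 i + Finsupp.single 1 j) ↔ (k = i ∧ l = j) := by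
    intro k l
    constructor
    · intro h
      have h0 := DFunLike.congr_fun h 0
      have h1 := DFunLike.congr_fun h 1
      simpa using And.intro h0 h1
    · rintro ⟨rfl, rfl⟩
      rfl
  simp only [cf, MvPolynomial.coeff_sum, MvPolynomial.coeff_monomial, key, ite_and]
  by_cases hij : n < i + j
  · rw [hc i j hij]
    refine Finset.sum_eq_zero fun k _ => Finset.sum_eq_zero fun l _ => ?_
    split_ifs with h1 h2
    · rw [h1, h2, hc i j hij]
    · rfl
    · rfl
  · rw [Finset.sum_eq_single i, Finset.sum_eq_single j]
    · simp
    · intro l _ hl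
      simp [hl]
    · intro h
      simp at h
      omega
    · intro k _ hk
      simp [hk]
    · intro h
      simp at h
      omega

/-- Polynomials of degree at most `n` that are eigenvectors of the Jacobi operator and whose
coefficients satisfy the second order recurrence with parameters `σ`, `p` that encodes the
vanishing of the discrepancy operator. -/
structure IsCommonEigen (n : ℕ) (σ p : ℝ) (u : MvPolynomial (Fin 2) ℝ) : Prop where
  cf_eq_zero : ∀ i j, n < i + j → cf u i j = 0
  eigen : ∀ i j : ℕ, (i + 1) * (i + 2) * cf u (i + 1) j + (j + 1) * (j + 2) * cf u i (j + 1) +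
    (n * (n + 5) - (i + j) * (i + j + 5)) * cf u i j = 0
  cf_one : ∀ i : ℕ, 2 * cf u i 1 = σ * (i + 1) * cf u (i + 1) 0
  cf_add_two : ∀ i j : ℕ, (j + 2) * (j + 3) * cf u i (j + 2) =
    σ * (i + 1) * (j + 2) * cf u (i + 1) (j + 1) - p * (i + 1) * (i + 2) * cf u (i + 2) j

lemma eigenvalue_sub_pos {i n : ℕ} (h : i < n) : (0 : ℝ) < n * (n + 5) - i * (i + 5) := by
  have h1 : (i : ℝ) < n := by exact_mod_cast h
  have h2 : (0 : ℝ) ≤ i := i.cast_nonneg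
  nlinarith

namespace IsCommonEigen

variable {n : ℕ} {σ p : ℝ} {u v : MvPolynomial (Fin 2) ℝ}

lemma cf_zero_rec (h : IsCommonEigen n σ p u) (i : ℕ) :
    ((i : ℝ) + 1) * (i + 2 + σ) * cf u (i + 1) 0 +
      (n * (n + 5) - i * (i + 5)) * cf u i 0 = 0 := by
  have h1 := h.eigen i 0
  have h2 := h.cf_one i
  push_cast at h1
  simp only [zero_add, add_zero] at h1
  linear_combination h1 - h2

lemma eq_zero (h : IsCommonEigen n σ p u) (hn : cf u n 0 = 0) : u = 0 := by
  have h0 : ∀ m k : ℕ, n ≤ k + m → cf u k 0 = 0 := by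
    intro m
    induction m with
    | zero =>
      intro k hk
      rcases hk.eq_or_lt with rfl | hk
      · exact hn
      · exact h.cf_eq_zero k 0 hk
    | succ m ih =>
      intro k hk
      by_cases hkn : k < n
      · have h1 := h.cf_zero_rec k
        rw [ih (k + 1) (by omega), mul_zero, zero_add] at h1
        exact (mul_eq_zero.1 h1).resolve_left (eigenvalue_sub_pos hkn).ne'
      · exact ih k (by omega)
  have h1 : ∀ j : ℕ, (∀ i, cf u i j = 0) ∧ ∀ i, cf u i (j + 1) = 0 := by
    intro j
    induction j with
    | zero =>
      refine ⟨fun i => h0 n i (by omega), fun i => ?_⟩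
      have := h.cf_one i
      rw [h0 n (i + 1) (by omega)] at this
      simpa using this
    | succ j ih =>
      refine ⟨ih.2, fun i => ?_⟩
      have := h.cf_add_two i j
      rw [ih.2, ih.1, mul_zero, mul_zero, sub_zero] at this
      exact (mul_eq_zero.1 this).resolve_left (by positivity)
  exact ext_cf fun i j => by simp [(h1 j).1 i]

lemma sub_smul (hu : IsCommonEigen n σ p u) (hv : IsCommonEigen n σ p v) (t : ℝ) :
    IsCommonEigen n σ p (u - t • v) where
  cf_eq_zero i j hij := by simp [hu.cf_eq_zero i j hij, hv.cf_eq_zero i j hij]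
  eigen i j := by
    simp only [cf_sub, cf_smul]
    linear_combination hu.eigen i j - t * hv.eigen i j
  cf_one i := by
    simp only [cf_sub, cf_smul]
    linear_combination hu.cf_one i - t * hv.cf_one i
  cf_add_two i j := by
    simp only [cf_sub, cf_smul]
    linear_combination hu.cf_add_two i j - t * hv.cf_add_two i j

lemma smul (hu : IsCommonEigen n σ p u) (t : ℝ) : IsCommonEigen n σ p (t • u) where
  cf_eq_zero i j hij := by simp [hu.cf_eq_zero i j hij]
  eigen i j := by
    simp only [cf_smul]
    linear_combination t * hu.eigen i j
  cf_one i := by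
    simp only [cf_smul]
    linear_combination t * hu.cf_one i
  cf_add_two i j := by
    simp only [cf_smul]
    linear_combination t * hu.cf_add_two i j

lemma eq_smul (hu : IsCommonEigen n σ p u) (hv : IsCommonEigen n σ p v) (hv0 : v ≠ 0) :
    u = (cf u n 0 / cf v n 0) • v := by
  have h : cf v n 0 ≠ 0 := fun h => hv0 (hv.eq_zero h)
  refine sub_eq_zero.1 ((hu.sub_smul hv _).eq_zero ?_)
  simp [h]

lemma two_mul_param (h : IsCommonEigen n σ p u) (hn : 2 ≤ n) (hu : u ≠ 0) :
    2 * p = σ * (σ - 1) := by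
  obtain ⟨m, rfl⟩ := Nat.exists_eq_add_of_le' hn
  have h0 : cf u (m + 2) 0 ≠ 0 := fun h' => hu (h.eq_zero h')
  have e0 := h.cf_zero_rec (m + 1)
  have e1 := h.eigen m 1
  have e2 := h.cf_one m
  have e3 := h.cf_one (m + 1)
  have e4 := h.cf_add_two m 0
  push_cast at e0 e1 e2 e3 e4
  norm_num only [zero_add, add_assoc] at e0 e1 e2 e3 e4
  have hm : (0 : ℝ) < (m + 1) * (m + 2) := by positivity
  refine mul_right_cancel₀ (mul_ne_zero hm.ne' h0) ?_
  linear_combination (-2) * e1 + 2 * e4 + ((m + 1) * (m + 2) + 2 * σ * (m + 1)) * e3 +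
    (2 * m + 8) * e2 + σ * (m + 1) * e0

lemma param_cases (h : IsCommonEigen n σ p u) (hn : 3 ≤ n) (hu : u ≠ 0) :
    σ = 0 ∨ σ = 1 ∨ σ = 2 := by
  have hp := h.two_mul_param (by omega) hu
  obtain ⟨m, rfl⟩ := Nat.exists_eq_add_of_le' hn
  have h0 : cf u (m + 3) 0 ≠ 0 := fun h' => hu (h.eq_zero h')
  have e0 := h.cf_zero_rec (m + 2)
  have e1 := h.eigen m 2
  have e2 := h.cf_one (m + 1)
  have e3 := h.cf_one (m + 2)
  have e4 := h.cf_add_two m 0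
  have e5 := h.cf_add_two (m + 1) 0
  have e6 := h.cf_add_two m 1
  push_cast at e0 e1 e2 e3 e4 e5 e6
  norm_num only [zero_add, add_assoc] at e0 e1 e2 e3 e4 e5 e6
  have f4 : 6 * cf u m 2 = (m + 1) * (m + 2) * (σ ^ 2 - p) * cf u (m + 2) 0 := by
    linear_combination e4 + σ * (m + 1) * e2
  have f5 : 6 * cf u (m + 1) 2 = (m + 2) * (m + 3) * (σ ^ 2 - p) * cf u (m + 3) 0 := by
    linear_combination e5 + σ * (m + 2) * e3
  have hm : (0 : ℝ) < (m + 1) * (m + 2) * (m + 3) := by positivity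
  have key : σ * ((σ - 1) * (σ - 2)) = 0 := by
    refine (mul_eq_zero.1 (?_ : ((m + 1) * (m + 2) * (m + 3) * cf u (m + 3) 0) *
      (σ * ((σ - 1) * (σ - 2))) = 0)).resolve_left (mul_ne_zero hm.ne' h0)
    linear_combination (-12) * e1 + 12 * e6 +
      2 * ((m + 1) * (m + 2) + 3 * σ * (m + 1)) * f5 + 2 * (2 * m + 10) * f4 +
      2 * (m + 1) * (m + 2) * (σ ^ 2 - p) * e0 - 6 * p * (m + 1) * (m + 2) * e3 -
      (5 * σ - 2) * (m + 1) * (m + 2) * (m + 3) * cf u (m + 3) 0 * hp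
  rcases mul_eq_zero.1 key with h1 | h1
  · exact Or.inl h1
  rcases mul_eq_zero.1 h1 with h1 | h1
  · exact Or.inr (Or.inl (by linarith))
  · exact Or.inr (Or.inr (by linarith))

end IsCommonEigen

/-- Values at the edge `y = 0` of the common eigenvector, normalised by its leading coefficient. -/
def edgeCoeff (n : ℕ) (σ : ℝ) (k : ℕ) : ℝ :=
  if k ≤ n then ∏ l ∈ Finset.Ico k n,
    (((l : ℝ) + 1) * (l + 2 + σ) / (l * (l + 5) - n * (n + 5))) else 0

lemma edgeCoeff_of_lt {n k : ℕ} (σ : ℝ) (h : n < k) : edgeCoeff n σ k = 0 :=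
  if_neg h.not_ge

lemma edgeCoeff_rec (n : ℕ) (σ : ℝ) (k : ℕ) :
    ((k : ℝ) + 1) * (k + 2 + σ) * edgeCoeff n σ (k + 1) =
      (k * (k + 5) - n * (n + 5)) * edgeCoeff n σ k := by
  rcases lt_trichotomy k n with h | rfl | h
  · have h0 : ((k : ℝ) * (k + 5) - n * (n + 5)) ≠ 0 := by
      have := eigenvalue_sub_pos h
      intro h'
      linarith
    rw [edgeCoeff, edgeCoeff, if_pos h.le, if_pos (by omega), Finset.prod_eq_prod_Ico_succ_bot h]
    field_simp
  · simp [edgeCoeff]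
  · rw [edgeCoeff_of_lt σ h, edgeCoeff_of_lt σ (by omega), mul_zero, mul_zero]

/-- The factors `(σ)_j / (j! (j + 1)!)` relating coefficients at different heights. -/
def heightCoeff (σ : ℝ) : ℕ → ℝ
  | 0 => 1
  | j + 1 => (j + σ) / ((j + 1) * (j + 2)) * heightCoeff σ j

lemma heightCoeff_succ (σ : ℝ) (j : ℕ) :
    ((j : ℝ) + 1) * (j + 2) * heightCoeff σ (j + 1) = (j + σ) * heightCoeff σ j := by
  rw [heightCoeff]
  field_simp

lemma heightCoeff_zero_succ (j : ℕ) : heightCoeff 0 (j + 1) = 0 := by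
  induction j with
  | zero => simp [heightCoeff]
  | succ j ih => rw [heightCoeff, ih, mul_zero]

lemma exists_isCommonEigen {n : ℕ} {σ p : ℝ} (hp : 2 * p = σ * (σ - 1))
    (hσ : n = 2 ∨ σ = 0 ∨ σ = 1 ∨ σ = 2) :
    ∃ u : MvPolynomial (Fin 2) ℝ, u ≠ 0 ∧ IsCommonEigen n σ p u := by
  obtain ⟨u, hu⟩ := exists_cf_eq n (fun i j => heightCoeff σ j *
      ((i + j).factorial / i.factorial) * edgeCoeff n σ (i + j)) (by
    intro i j hij
    simp [edgeCoeff_of_lt σ hij])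
  refine ⟨u, ?_, ?_, ?_, ?_, ?_⟩
  · rintro rfl
    have := hu n 0
    simp [heightCoeff, edgeCoeff, Nat.factorial_ne_zero] at this
  · intro i j hij
    simp [hu, edgeCoeff_of_lt σ hij]
  · intro i j
    have h1 := heightCoeff_succ σ j
    have h2 := edgeCoeff_rec n σ (i + j)
    have hi : (i.factorial : ℝ) ≠ 0 := by positivity
    simp only [hu, show i + 1 + j = i + j + 1 by ring, ← add_assoc, Nat.factorial_succ]
    push_cast at h2 ⊢
    field_simp
    linear_combination (i + j).factorial * heightCoeff σ j * h2 +
      (i + j).factorial * (i + j + 1) * edgeCoeff n σ (i + j + 1) * h1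
  · intro i
    have h1 := heightCoeff_succ σ 0
    have hi : (i.factorial : ℝ) ≠ 0 := by positivity
    simp only [hu, Nat.factorial_succ, add_zero, heightCoeff]
    push_cast
    field_simp
    ring
  · intro i j
    by_cases hij : n < i + (j + 2)
    · have h1 : n < i + 1 + (j + 1) := by omega
      have h2 : n < i + 2 + j := by omega
      simp [hu, edgeCoeff_of_lt σ hij, edgeCoeff_of_lt σ h1, edgeCoeff_of_lt σ h2]
    have h1 := heightCoeff_succ σ j
    have h2 : (j + 2 : ℝ) * (j + 3) * heightCoeff σ (j + 2) =
        (j + 1 + σ) * heightCoeff σ (j + 1) := by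
      have := heightCoeff_succ σ (j + 1)
      push_cast at this
      linear_combination this
    have h3 : ((1 - σ) * (j + σ) + p * (j + 2)) * heightCoeff σ j = 0 := by
      rcases hσ with rfl | rfl | rfl | rfl
      · obtain rfl : j = 0 := by omega
        push_cast
        linear_combination heightCoeff σ 0 * hp
      · have hp0 : p = 0 := by linarith
        rcases j with _ | j
        · simp [hp0]
        · rw [heightCoeff_zero_succ, mul_zero]
      · have hp0 : p = 0 := by linarith
        simp [hp0]
      · have hp0 : p = 1 := by linarith
        rw [hp0]
        ring
    have hi : (i.factorial : ℝ) ≠ 0 := by positivity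
    simp only [hu, show i + 1 + (j + 1) = i + j + 2 by ring, show i + 2 + j = i + j + 2 by ring,
      ← add_assoc, Nat.factorial_succ]
    push_cast
    field_simp
    refine mul_left_cancel₀ (by positivity : (j + 2 : ℝ) ≠ 0) ?_
    linear_combination edgeCoeff n σ (i + j + 2) * (i + 2) *
      (h3 + (j + 2) * h2 + (1 - σ) * h1)

/-- Substitution of the affine parametrisation `(x, y) ↦ P + x Q + y R` into a polynomial. -/
def affineSubst (P Q R : ℝ × ℝ) : MvPolynomial (Fin 2) ℝ →ₐ[ℝ] MvPolynomial (Fin 2) ℝ :=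
  MvPolynomial.aeval ![
    MvPolynomial.C P.1 + MvPolynomial.C Q.1 * MvPolynomial.X 0 +
      MvPolynomial.C R.1 * MvPolynomial.X 1,
    MvPolynomial.C P.2 + MvPolynomial.C Q.2 * MvPolynomial.X 0 +
      MvPolynomial.C R.2 * MvPolynomial.X 1]

lemma affineSubst_C (P Q R : ℝ × ℝ) (a : ℝ) :
    affineSubst P Q R (MvPolynomial.C a) = MvPolynomial.C a :=
  (affineSubst P Q R).commutes a

lemma affineSubst_X_zero (P Q R : ℝ × ℝ) :
    affineSubst P Q R (MvPolynomial.X 0) = MvPolynomial.C P.1 +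
      MvPolynomial.C Q.1 * MvPolynomial.X 0 + MvPolynomial.C R.1 * MvPolynomial.X 1 := by
  simp [affineSubst]

lemma affineSubst_X_one (P Q R : ℝ × ℝ) :
    affineSubst P Q R (MvPolynomial.X 1) = MvPolynomial.C P.2 +
      MvPolynomial.C Q.2 * MvPolynomial.X 0 + MvPolynomial.C R.2 * MvPolynomial.X 1 := by
  simp [affineSubst]

lemma evalP_affineSubst (P Q R : ℝ × ℝ) (u : MvPolynomial (Fin 2) ℝ) (p : ℝ × ℝ) :
    evalP (affineSubst P Q R u) p = evalP u (P + p.1 • Q + p.2 • R) := by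
  induction u using MvPolynomial.induction_on with
  | C a => simp [evalP]
  | add u v hu hv => simpa [evalP] using congrArg₂ (· + ·) hu hv
  | mul_X u i hu =>
    simp only [evalP, map_mul] at hu ⊢
    rw [hu]
    congr 1
    fin_cases i
    · simp [affineSubst_X_zero, mul_comm]
    · simp [affineSubst_X_one, mul_comm]

lemma ext_evalP {u v : MvPolynomial (Fin 2) ℝ} (h : ∀ p, evalP u p = evalP v p) : u = v := by
  refine MvPolynomial.funext fun x => ?_
  have hx : ![x 0, x 1] = x := by
    ext i
    fin_cases i <;> rfl
  have := h (x 0, x 1)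
  rwa [evalP, evalP, hx] at this

lemma affineSubst_comp (P Q R P' Q' R' : ℝ × ℝ) (u : MvPolynomial (Fin 2) ℝ) :
    affineSubst P' Q' R' (affineSubst P Q R u) = affineSubst (P + P'.1 • Q + P'.2 • R)
      (Q'.1 • Q + Q'.2 • R) (R'.1 • Q + R'.2 • R) u := by
  refine ext_evalP fun p => ?_
  simp only [evalP_affineSubst]
  congr 1
  ext <;> simp <;> ring

lemma affineSubst_id (u : MvPolynomial (Fin 2) ℝ) : affineSubst 0 (1, 0) (0, 1) u = u :=
  ext_evalP fun p => by simp [evalP_affineSubst]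

lemma exists_affineSubst_inverse (P : ℝ × ℝ) {Q R : ℝ × ℝ} (h : det2 Q R ≠ 0) :
    ∃ P' Q' R' : ℝ × ℝ, ∀ u,
      affineSubst P' Q' R' (affineSubst P Q R u) = u ∧
      affineSubst P Q R (affineSubst P' Q' R' u) = u := by
  refine ⟨(-det2 P R / det2 Q R, -det2 Q P / det2 Q R), (R.2 / det2 Q R, -Q.2 / det2 Q R),
    (-R.1 / det2 Q R, Q.1 / det2 Q R), fun u => ⟨?_, ?_⟩⟩ <;>
  · rw [affineSubst_comp]
    conv_rhs => rw [← affineSubst_id u]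
    congr 2 <;> ext <;> simp <;> field_simp <;> simp only [det2] <;> ring

lemma totalDegree_affineSubst_le (P Q R : ℝ × ℝ) (u : MvPolynomial (Fin 2) ℝ) :
    (affineSubst P Q R u).totalDegree ≤ u.totalDegree := by
  have hX : ∀ i : Fin 2, (affineSubst P Q R (MvPolynomial.X i)).totalDegree ≤ 1 := by
    have h : ∀ a b c : ℝ, (MvPolynomial.C a + MvPolynomial.C b * MvPolynomial.X 0 +
        MvPolynomial.C c * MvPolynomial.X 1 : MvPolynomial (Fin 2) ℝ).totalDegree ≤ 1 := by
      intro a b c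
      refine (MvPolynomial.totalDegree_add _ _).trans (max_le
        ((MvPolynomial.totalDegree_add _ _).trans (max_le ?_ ?_)) ?_)
      · simp
      · exact (MvPolynomial.totalDegree_mul _ _).trans (by simp)
      · exact (MvPolynomial.totalDegree_mul _ _).trans (by simp)
    intro i
    fin_cases i
    · exact (congrArg _ (affineSubst_X_zero P Q R)).trans_le (h _ _ _)
    · exact (congrArg _ (affineSubst_X_one P Q R)).trans_le (h _ _ _)
  conv_lhs => rw [MvPolynomial.as_sum u, map_sum]
  refine MvPolynomial.totalDegree_finsetSum_le fun m hm => ?_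
  rw [MvPolynomial.monomial_eq, map_mul, affineSubst_C]
  refine (MvPolynomial.totalDegree_mul _ _).trans ?_
  rw [MvPolynomial.totalDegree_C, zero_add, Finsupp.prod, map_prod]
  refine (MvPolynomial.totalDegree_finsetProd _ _).trans
    (le_trans ?_ (MvPolynomial.le_totalDegree hm))
  refine Finset.sum_le_sum fun i _ => ?_
  rw [map_pow]
  refine (MvPolynomial.totalDegree_pow _ _).trans ?_
  simpa using Nat.mul_le_mul_left (m i) (hX i)

lemma pderiv_zero_affineSubst (P Q R : ℝ × ℝ) (u : MvPolynomial (Fin 2) ℝ) :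
    MvPolynomial.pderiv 0 (affineSubst P Q R u) =
      MvPolynomial.C Q.1 * affineSubst P Q R (MvPolynomial.pderiv 0 u) +
        MvPolynomial.C Q.2 * affineSubst P Q R (MvPolynomial.pderiv 1 u) := by
  induction u using MvPolynomial.induction_on with
  | C a => simp
  | add u v hu hv =>
    simp only [map_add, hu, hv]
    ring
  | mul_X u i hu =>
    fin_cases i
    · simp [hu, affineSubst_X_zero]
      ring
    · simp [hu, affineSubst_X_one]
      ring

lemma pderiv_one_affineSubst (P Q R : ℝ × ℝ) (u : MvPolynomial (Fin 2) ℝ) :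
    MvPolynomial.pderiv 1 (affineSubst P Q R u) =
      MvPolynomial.C R.1 * affineSubst P Q R (MvPolynomial.pderiv 0 u) +
        MvPolynomial.C R.2 * affineSubst P Q R (MvPolynomial.pderiv 1 u) := by
  induction u using MvPolynomial.induction_on with
  | C a => simp
  | add u v hu hv =>
    simp only [map_add, hu, hv]
    ring
  | mul_X u i hu =>
    fin_cases i
    · simp [hu, affineSubst_X_zero]
      ring
    · simp [hu, affineSubst_X_one]
      ring

lemma jacobi_affineSubst (a b : ℝ) (u : MvPolynomial (Fin 2) ℝ) :
    MvPolynomial.C b * jacobi (affineSubst 0 (1, 0) (a, -b) u) =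
      affineSubst 0 (1, 0) (a, -b) (MvPolynomial.C b * jacobi u - discrepancy a b u) := by
  simp only [jacobi, euler, discrepancy, map_add, map_sub, map_mul, MvPolynomial.pderiv_mul,
    MvPolynomial.pderiv_C, MvPolynomial.pderiv_one, pderiv_zero_affineSubst,
      pderiv_one_affineSubst, affineSubst_C,
    affineSubst_X_zero, affineSubst_X_one, MvPolynomial.pderiv_X_self,
    MvPolynomial.pderiv_X_of_ne (show (1 : Fin 2) ≠ 0 by decide),
    MvPolynomial.pderiv_X_of_ne (show (0 : Fin 2) ≠ 1 by decide), pderiv_one_pderiv_zero,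
    map_zero, map_one, Prod.fst_zero, Prod.snd_zero, map_neg, map_ofNat]
  ring

/-- Eigenvectors of the Jacobi operator of degree at most `n`, for the `n`-th eigenvalue. -/
def IsEigen (n : ℕ) (u : MvPolynomial (Fin 2) ℝ) : Prop :=
  u.totalDegree ≤ n ∧ jacobi u = MvPolynomial.C (-(n * (n + 5) : ℝ)) * u

lemma isEigen_and_iff {n : ℕ} {a b : ℝ} (hb : 0 < b) (u : MvPolynomial (Fin 2) ℝ) :
    (IsEigen n u ∧ IsEigen n (affineSubst 0 (1, 0) (a, -b) u)) ↔
      IsCommonEigen n (2 * a / (1 + b)) (a * (a - 1) / (b * (1 + b))) u := by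
  have hb1 : 0 < 1 + b := by linarith
  have hdet : det2 (1, 0) (a, -b) ≠ 0 := by simp [det2, hb.ne']
  have hdisc : jacobi u = MvPolynomial.C (-(n * (n + 5) : ℝ)) * u →
      (jacobi (affineSubst 0 (1, 0) (a, -b) u) =
        MvPolynomial.C (-(n * (n + 5) : ℝ)) * affineSubst 0 (1, 0) (a, -b) u ↔
          discrepancy a b u = 0) := by
    intro hu
    have h := jacobi_affineSubst a b u
    rw [hu, map_sub, map_mul, map_mul, affineSubst_C, affineSubst_C] at h
    have hCb : (MvPolynomial.C b : MvPolynomial (Fin 2) ℝ) ≠ 0 :=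
      (map_ne_zero_iff _ (MvPolynomial.C_injective _ _)).2 hb.ne'
    obtain ⟨P', Q', R', hinv⟩ := exists_affineSubst_inverse 0 hdet
    constructor
    · intro hj
      rw [hj, eq_comm, sub_eq_self] at h
      rw [← (hinv (discrepancy a b u)).1, h, map_zero]
    · intro hd
      rw [hd, map_zero, sub_zero] at h
      exact mul_left_cancel₀ hCb h
  have hrec : discrepancy a b u = 0 ↔
      (∀ i : ℕ, 2 * cf u i 1 = 2 * a / (1 + b) * (i + 1) * cf u (i + 1) 0) ∧
      ∀ i j : ℕ, (j + 2) * (j + 3) * cf u i (j + 2) =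
        2 * a / (1 + b) * (i + 1) * (j + 2) * cf u (i + 1) (j + 1) -
          a * (a - 1) / (b * (1 + b)) * (i + 1) * (i + 2) * cf u (i + 2) j := by
    have h0 : ∀ i, cf (discrepancy a b u) i 0 = b * (1 + b) *
        (2 * cf u i 1 - 2 * a / (1 + b) * (i + 1) * cf u (i + 1) 0) := by
      intro i
      rw [cf_discrepancy_zero]
      field_simp
    have h1 : ∀ i j, cf (discrepancy a b u) i (j + 1) = b * (1 + b) *
        ((j + 2) * (j + 3) * cf u i (j + 2) -
        (2 * a / (1 + b) * (i + 1) * (j + 2) * cf u (i + 1) (j + 1) -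
          a * (a - 1) / (b * (1 + b)) * (i + 1) * (i + 2) * cf u (i + 2) j)) := by
      intro i j
      rw [cf_discrepancy_succ]
      field_simp
      ring
    have hne : b * (1 + b) ≠ 0 := by positivity
    constructor
    · intro h
      refine ⟨fun i => ?_, fun i j => ?_⟩
      · have := h0 i
        rw [h, cf_zero, eq_comm] at this
        exact sub_eq_zero.1 ((mul_eq_zero.1 this).resolve_left hne)
      · have := h1 i j
        rw [h, cf_zero, eq_comm] at this
        exact sub_eq_zero.1 ((mul_eq_zero.1 this).resolve_left hne)
    · rintro ⟨g0, g1⟩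
      refine ext_cf fun i j => ?_
      rcases j with _ | j
      · rw [h0, g0, sub_self, mul_zero, cf_zero]
      · rw [h1, g1, sub_self, mul_zero, cf_zero]
  have heig : jacobi u = MvPolynomial.C (-(n * (n + 5) : ℝ)) * u ↔
      ∀ i j : ℕ, (i + 1) * (i + 2) * cf u (i + 1) j + (j + 1) * (j + 2) * cf u i (j + 1) +
        (n * (n + 5) - (i + j) * (i + j + 5)) * cf u i j = 0 := by
    constructor
    · intro h i j
      have := congrArg (cf · i j) h
      simp only [cf_jacobi, cf_C_mul] at this
      linear_combination this
    · intro h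
      refine ext_cf fun i j => ?_
      rw [cf_jacobi, cf_C_mul]
      linear_combination h i j
  constructor
  · rintro ⟨⟨hd, hj⟩, -, hj'⟩
    have hq := hrec.1 ((hdisc hj).1 hj')
    exact ⟨totalDegree_le_iff_cf.1 hd, heig.1 hj, hq.1, hq.2⟩
  · rintro ⟨hd, hj, hq⟩
    have hd' := totalDegree_le_iff_cf.2 hd
    exact ⟨⟨hd', heig.2 hj⟩, (totalDegree_affineSubst_le _ _ _ _).trans hd',
      (hdisc (heig.2 hj)).2 (hrec.2 ⟨‹_›, ‹_›⟩)⟩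

lemma hasDerivAt_evalP_fst (u : MvPolynomial (Fin 2) ℝ) (x y : ℝ) :
    HasDerivAt (fun t => evalP u (t, y)) (evalP (MvPolynomial.pderiv 0 u) (x, y)) x := by
  induction u using MvPolynomial.induction_on with
  | C a => simpa [evalP] using hasDerivAt_const x a
  | add u v hu hv =>
    have h : HasDerivAt (fun t => evalP u (t, y) + evalP v (t, y)) _ x := hu.add hv
    simpa [evalP] using h
  | mul_X u i hu =>
    fin_cases i
    · have h : HasDerivAt (fun t => evalP u (t, y) * t) _ x := hu.mul (hasDerivAt_id x)
      have hf : (fun t => evalP u (t, y) * t) =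
          fun t => evalP (u * MvPolynomial.X 0) (t, y) := by
        simp [evalP]
      refine (hf ▸ h).congr_deriv ?_
      simp [evalP]
      ring
    · have h : HasDerivAt (fun t => evalP u (t, y) * y) _ x := hu.mul_const y
      have hf : (fun t => evalP u (t, y) * y) =
          fun t => evalP (u * MvPolynomial.X 1) (t, y) := by
        simp [evalP]
      refine (hf ▸ h).congr_deriv ?_
      simp [evalP]
      ring

lemma hasDerivAt_evalP_snd (u : MvPolynomial (Fin 2) ℝ) (x y : ℝ) :
    HasDerivAt (fun t => evalP u (x, t)) (evalP (MvPolynomial.pderiv 1 u) (x, y)) y := by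
  induction u using MvPolynomial.induction_on with
  | C a => simpa [evalP] using hasDerivAt_const y a
  | add u v hu hv =>
    have h : HasDerivAt (fun t => evalP u (x, t) + evalP v (x, t)) _ y := hu.add hv
    simpa [evalP] using h
  | mul_X u i hu =>
    fin_cases i
    · have h : HasDerivAt (fun t => evalP u (x, t) * x) _ y := hu.mul_const x
      have hf : (fun t => evalP u (x, t) * x) =
          fun t => evalP (u * MvPolynomial.X 0) (x, t) := by
        simp [evalP]
      refine (hf ▸ h).congr_deriv ?_
      simp [evalP]
      ring
    · have h : HasDerivAt (fun t => evalP u (x, t) * t) _ y := hu.mul (hasDerivAt_id y)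
      have hf : (fun t => evalP u (x, t) * t) =
          fun t => evalP (u * MvPolynomial.X 1) (x, t) := by
        simp [evalP]
      refine (hf ▸ h).congr_deriv ?_
      simp [evalP]
      ring

lemma isClosed_refTriangle : IsClosed refTriangle :=
  (isClosed_le continuous_const continuous_fst).inter
    ((isClosed_le continuous_const continuous_snd).inter
      (isClosed_le (continuous_fst.add continuous_snd) continuous_const))

lemma isCompact_refTriangle : IsCompact refTriangle := by
  refine (isCompact_Icc (a := ((0, 0) : ℝ × ℝ)) (b := (1, 1))).of_isClosed_subset
    isClosed_refTriangle fun p hp => ?_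
  obtain ⟨h1, h2, h3⟩ := hp
  exact ⟨⟨h1, h2⟩, ⟨by dsimp only; linarith, by dsimp only; linarith⟩⟩

lemma integrableOn_evalP (u : MvPolynomial (Fin 2) ℝ) : IntegrableOn (evalP u) refTriangle :=
  (continuous_evalP u).continuousOn.integrableOn_compact isCompact_refTriangle

lemma integrable_indicator_evalP (u : MvPolynomial (Fin 2) ℝ) :
    Integrable (refTriangle.indicator (evalP u)) :=
  (integrable_indicator_iff isClosed_refTriangle.measurableSet).2 (integrableOn_evalP u)

/-- The bubble of the reference triangle. -/
def refBubble : MvPolynomial (Fin 2) ℝ :=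
  MvPolynomial.X 0 * MvPolynomial.X 1 * (1 - MvPolynomial.X 0 - MvPolynomial.X 1)

lemma evalP_refBubble (p : ℝ × ℝ) : evalP refBubble p = p.1 * p.2 * (1 - p.1 - p.2) := by
  simp [evalP, refBubble]

lemma evalP_mul (u v : MvPolynomial (Fin 2) ℝ) (p : ℝ × ℝ) :
    evalP (u * v) p = evalP u p * evalP v p := map_mul _ _ _

lemma integral_pderiv_zero_refBubble_mul (u : MvPolynomial (Fin 2) ℝ) :
    ∫ p in refTriangle, evalP (MvPolynomial.pderiv 0 (refBubble * u)) p = 0 := by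
  rw [← integral_indicator isClosed_refTriangle.measurableSet, Measure.volume_eq_prod,
    integral_prod_symm _ (integrable_indicator_evalP _)]
  refine integral_eq_zero_of_ae (Filter.Eventually.of_forall fun y => ?_)
  by_cases hy : 0 ≤ y ∧ y ≤ 1
  · have : ∀ x, refTriangle.indicator (evalP (MvPolynomial.pderiv 0 (refBubble * u))) (x, y) =
        (Set.Icc 0 (1 - y)).indicator
          (fun x => evalP (MvPolynomial.pderiv 0 (refBubble * u)) (x, y)) x := by
      intro x
      refine Set.indicator_eq_indicator ?_ rfl
      simp only [refTriangle, Set.mem_ofPred_eq, Set.mem_Icc]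
      constructor
      · rintro ⟨h1, h2, h3⟩
        exact ⟨h1, by linarith⟩
      · rintro ⟨h1, h2⟩
        exact ⟨h1, hy.1, by linarith⟩
    simp only [this, Pi.zero_apply]
    rw [integral_indicator measurableSet_Icc, integral_Icc_eq_integral_Ioc,
      ← intervalIntegral.integral_of_le (by linarith),
      intervalIntegral.integral_eq_sub_of_hasDerivAt
        (fun x _ => hasDerivAt_evalP_fst (refBubble * u) x y)
        (((continuous_evalP _).comp (by fun_prop)).intervalIntegrable _ _)]
    simp [evalP_mul, evalP_refBubble]
  · have : ∀ x, refTriangle.indicator (evalP (MvPolynomial.pderiv 0 (refBubble * u))) (x, y) =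
        0 := by
      intro x
      refine Set.indicator_of_notMem (fun h => hy ?_) _
      obtain ⟨h1, h2, h3⟩ := h
      dsimp only at h1 h2 h3
      exact ⟨h2, by linarith⟩
    simp only [this, integral_zero, Pi.zero_apply]

lemma integral_pderiv_one_refBubble_mul (u : MvPolynomial (Fin 2) ℝ) :
    ∫ p in refTriangle, evalP (MvPolynomial.pderiv 1 (refBubble * u)) p = 0 := by
  rw [← integral_indicator isClosed_refTriangle.measurableSet, Measure.volume_eq_prod,
    integral_prod _ (integrable_indicator_evalP _)]
  refine integral_eq_zero_of_ae (Filter.Eventually.of_forall fun x => ?_)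
  by_cases hx : 0 ≤ x ∧ x ≤ 1
  · have : ∀ y, refTriangle.indicator (evalP (MvPolynomial.pderiv 1 (refBubble * u))) (x, y) =
        (Set.Icc 0 (1 - x)).indicator
          (fun y => evalP (MvPolynomial.pderiv 1 (refBubble * u)) (x, y)) y := by
      intro y
      refine Set.indicator_eq_indicator ?_ rfl
      simp only [refTriangle, Set.mem_ofPred_eq, Set.mem_Icc]
      constructor
      · rintro ⟨h1, h2, h3⟩
        exact ⟨h2, by linarith⟩
      · rintro ⟨h1, h2⟩
        exact ⟨hx.1, h1, by linarith⟩
    simp only [this, Pi.zero_apply]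
    rw [integral_indicator measurableSet_Icc, integral_Icc_eq_integral_Ioc,
      ← intervalIntegral.integral_of_le (by linarith),
      intervalIntegral.integral_eq_sub_of_hasDerivAt
        (fun y _ => hasDerivAt_evalP_snd (refBubble * u) x y)
        (((continuous_evalP _).comp (by fun_prop)).intervalIntegrable _ _)]
    simp [evalP_mul, evalP_refBubble]
  · have : ∀ y, refTriangle.indicator (evalP (MvPolynomial.pderiv 1 (refBubble * u))) (x, y) =
        0 := by
      intro y
      refine Set.indicator_of_notMem (fun h => hx ?_) _
      obtain ⟨h1, h2, h3⟩ := h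
      dsimp only at h1 h2 h3
      exact ⟨h1, by linarith⟩
    simp only [this, integral_zero, Pi.zero_apply]

/-- The weighted inner product on the reference triangle. -/
def refInner (u v : MvPolynomial (Fin 2) ℝ) : ℝ :=
  ∫ p in refTriangle, evalP (u * v * refBubble) p

lemma refInner_add_left (u v w : MvPolynomial (Fin 2) ℝ) :
    refInner (u + v) w = refInner u w + refInner v w := by
  rw [refInner, refInner, refInner, ← integral_add (integrableOn_evalP _) (integrableOn_evalP _)]
  simp only [evalP, add_mul, map_add]

lemma refInner_C_mul_left (a : ℝ) (u w : MvPolynomial (Fin 2) ℝ) :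
    refInner (MvPolynomial.C a * u) w = a * refInner u w := by
  rw [refInner, refInner, ← integral_const_mul]
  simp only [evalP, mul_assoc, map_mul, MvPolynomial.eval_C]

lemma refInner_comm (u v : MvPolynomial (Fin 2) ℝ) : refInner u v = refInner v u := by
  rw [refInner, refInner, mul_comm u v]

lemma refInner_jacobi_comm (u v : MvPolynomial (Fin 2) ℝ) :
    refInner (jacobi u) v = refInner u (jacobi v) := by
  have key : jacobi u * v * refBubble - u * jacobi v * refBubble =
      MvPolynomial.pderiv 0 (refBubble * (
        MvPolynomial.X 0 * (1 - MvPolynomial.X 0) *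
          (MvPolynomial.pderiv 0 u * v - u * MvPolynomial.pderiv 0 v) -
        MvPolynomial.X 0 * MvPolynomial.X 1 *
          (MvPolynomial.pderiv 1 u * v - u * MvPolynomial.pderiv 1 v))) +
      MvPolynomial.pderiv 1 (refBubble * (
        MvPolynomial.X 1 * (1 - MvPolynomial.X 1) *
          (MvPolynomial.pderiv 1 u * v - u * MvPolynomial.pderiv 1 v) -
        MvPolynomial.X 0 * MvPolynomial.X 1 *
          (MvPolynomial.pderiv 0 u * v - u * MvPolynomial.pderiv 0 v))) := by
    simp only [jacobi, euler, refBubble, map_add, map_sub, MvPolynomial.pderiv_mul,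
      MvPolynomial.pderiv_one, MvPolynomial.pderiv_X_self,
      MvPolynomial.pderiv_X_of_ne (show (1 : Fin 2) ≠ 0 by decide),
      MvPolynomial.pderiv_X_of_ne (show (0 : Fin 2) ≠ 1 by decide), pderiv_one_pderiv_zero, map_ofNat]
    ring
  rw [← sub_eq_zero, refInner, refInner,
    ← integral_sub (integrableOn_evalP _) (integrableOn_evalP _)]
  have h : ∀ p, evalP (jacobi u * v * refBubble) p - evalP (u * jacobi v * refBubble) p =
      evalP (jacobi u * v * refBubble - u * jacobi v * refBubble) p := fun p => by simp [evalP]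
  have hadd : ∀ f g : MvPolynomial (Fin 2) ℝ, ∀ p, evalP (f + g) p = evalP f p + evalP g p :=
    fun f g p => map_add _ _ _
  simp only [h, key, hadd]
  rw [integral_add (integrableOn_evalP _) (integrableOn_evalP _),
    integral_pderiv_zero_refBubble_mul, integral_pderiv_one_refBubble_mul, add_zero]

lemma eq_zero_of_refInner_self {u : MvPolynomial (Fin 2) ℝ} (h : refInner u u = 0) : u = 0 := by
  have hnn : ∀ p ∈ refTriangle, 0 ≤ evalP (u * u * refBubble) p := by
    rintro p ⟨h1, h2, h3⟩
    rw [evalP_mul, evalP_mul, evalP_refBubble]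
    have : 0 ≤ 1 - p.1 - p.2 := by linarith
    have := mul_self_nonneg (evalP u p)
    positivity
  have hae : evalP (u * u * refBubble) =ᵐ[volume.restrict refTriangle] 0 := by
    refine (setIntegral_eq_zero_iff_of_nonneg_ae ?_ (integrableOn_evalP _)).1 h
    exact (ae_restrict_iff' isClosed_refTriangle.measurableSet).2 (Filter.Eventually.of_forall hnn)
  let U : Set (ℝ × ℝ) := Set.Ioo 0 (1 / 2) ×ˢ Set.Ioo 0 (1 / 2)
  have hU : IsOpen U := isOpen_Ioo.prod isOpen_Ioo
  have hUT : U ⊆ refTriangle := by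
    rintro p ⟨⟨h1, h2⟩, h3, h4⟩
    exact ⟨h1.le, h3.le, by linarith⟩
  have hzero : Set.EqOn (evalP (u * u * refBubble)) 0 U :=
    Measure.eqOn_open_of_ae_eq (ae_restrict_of_ae_restrict_of_subset hUT hae) hU
      (continuous_evalP _).continuousOn continuousOn_const
  refine MvPolynomial.funext_set (fun _ => Set.Ioo (0 : ℝ) (1 / 2))
    (fun _ => Set.Ioo_infinite (by norm_num)) fun x hx => ?_
  have h0 := hx 0 trivial
  have h1 := hx 1 trivial
  have hz := hzero (x := (x 0, x 1)) ⟨h0, h1⟩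
  rw [evalP_mul, evalP_mul, evalP_refBubble] at hz
  have hne : x 0 * x 1 * (1 - x 0 - x 1) ≠ 0 := by
    have : 0 < 1 - x 0 - x 1 := by linarith [h0.2, h1.2]
    have := mul_pos (mul_pos h0.1 h1.1) this
    exact this.ne'
  have hx : ![x 0, x 1] = x := by
    ext i
    fin_cases i <;> rfl
  have := mul_self_eq_zero.1 ((mul_eq_zero.1 hz).resolve_right hne)
  rwa [evalP, hx] at this

/-- Polynomials of degree at most `n` orthogonal to all polynomials of degree at most `n - 1` on
the reference triangle. -/
def IsRefPerp (n : ℕ) (u : MvPolynomial (Fin 2) ℝ) : Prop :=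
  u.totalDegree ≤ n ∧ ∀ w : MvPolynomial (Fin 2) ℝ, w.totalDegree ≤ n - 1 → refInner u w = 0

lemma totalDegree_jacobi_add_le {n : ℕ} (hn : 0 < n) {u : MvPolynomial (Fin 2) ℝ}
    (hu : u.totalDegree ≤ n) :
    (jacobi u + MvPolynomial.C (n * (n + 5) : ℝ) * u).totalDegree ≤ n - 1 := by
  rw [totalDegree_le_iff_cf] at hu ⊢
  intro i j hij
  rw [cf_add, cf_jacobi, cf_C_mul, hu (i + 1) j (by omega), hu i (j + 1) (by omega)]
  rcases (show n ≤ i + j by omega).eq_or_lt with rfl | h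
  · push_cast
    ring
  · rw [hu i j h]
    ring

lemma totalDegree_jacobi_le {n : ℕ} {u : MvPolynomial (Fin 2) ℝ}
    (hu : u.totalDegree ≤ n) : (jacobi u).totalDegree ≤ n := by
  rw [totalDegree_le_iff_cf] at hu ⊢
  intro i j hij
  rw [cf_jacobi, hu (i + 1) j (by omega), hu i (j + 1) (by omega), hu i j hij]
  ring

lemma isRefPerp_iff_isEigen {n : ℕ} (hn : 0 < n) (u : MvPolynomial (Fin 2) ℝ) :
    IsRefPerp n u ↔ IsEigen n u := by
  refine and_congr_right fun hu => ⟨fun h => ?_, fun h => ?_⟩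
  · have hdeg := totalDegree_jacobi_add_le hn hu
    have hzero : jacobi u + MvPolynomial.C (n * (n + 5) : ℝ) * u = 0 := by
      refine eq_zero_of_refInner_self ?_
      rw [refInner_add_left, refInner_C_mul_left, h _ hdeg, refInner_jacobi_comm,
        h _ (totalDegree_jacobi_le hdeg), mul_zero, add_zero]
    rw [eq_neg_of_add_eq_zero_left hzero, map_neg, neg_mul]
  · have hu_jac : ∀ w, refInner u (jacobi w) = -(n * (n + 5) : ℝ) * refInner u w := fun w => by
      rw [← refInner_jacobi_comm, h, refInner_C_mul_left]
    have key : ∀ k, k < n → ∀ w : MvPolynomial (Fin 2) ℝ, w.totalDegree ≤ k →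
        refInner u w = 0 := by
      intro k
      induction k with
      | zero =>
        intro hk w hw
        have h0 : jacobi w = 0 := by
          rw [totalDegree_le_iff_cf] at hw
          refine ext_cf fun i j => ?_
          rw [cf_jacobi, hw (i + 1) j (by omega), hw i (j + 1) (by omega)]
          rcases Nat.eq_zero_or_pos (i + j) with hij | hij
          · have : (i : ℝ) + j = 0 := by exact_mod_cast hij
            simp [this]
          · simp [hw i j hij]
        have h1 := hu_jac w
        rw [h0] at h1
        have h2 : refInner u 0 = 0 := by simp [refInner, evalP]
        rw [h2] at h1
        have hpos := eigenvalue_sub_pos hk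
        refine (mul_eq_zero.1 h1.symm).resolve_left ?_
        push_cast at hpos
        intro h'
        linarith
      | succ k ih =>
        intro hk w hw
        have h1 := ih (by omega) _ (totalDegree_jacobi_add_le k.succ_pos hw)
        rw [refInner_comm, refInner_add_left, refInner_C_mul_left, refInner_comm,
          refInner_comm w, hu_jac] at h1
        have hpos := eigenvalue_sub_pos hk
        refine (mul_eq_zero.1 (?_ : ((n : ℝ) * (n + 5) - ((k + 1 : ℕ) : ℝ) * ((k + 1 : ℕ) + 5)) *
          refInner u w = 0)).resolve_left hpos.ne'
        linear_combination -h1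
    exact fun w hw => key (n - 1) (by omega) w hw

lemma convexHull_eq_image (A B C : ℝ × ℝ) :
    convexHull ℝ {A, B, C} =
      (fun p : ℝ × ℝ => A + p.1 • (B - A) + p.2 • (C - A)) '' refTriangle := by
  apply subset_antisymm
  · refine convexHull_min ?_ ?_
    · rintro _ (rfl | rfl | rfl)
      · exact ⟨(0, 0), by simp [refTriangle], by simp⟩
      · exact ⟨(1, 0), by simp [refTriangle], by simp⟩
      · exact ⟨(0, 1), by simp [refTriangle], by simp⟩
    · rintro _ ⟨p, ⟨hp1, hp2, hp3⟩, rfl⟩ _ ⟨q, ⟨hq1, hq2, hq3⟩, rfl⟩ s t hs ht hst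
      refine ⟨s • p + t • q, ⟨?_, ?_, ?_⟩, ?_⟩
      · exact add_nonneg (mul_nonneg hs hp1) (mul_nonneg ht hq1)
      · exact add_nonneg (mul_nonneg hs hp2) (mul_nonneg ht hq2)
      · simp only [Prod.fst_add, Prod.snd_add, Prod.smul_fst, Prod.smul_snd, smul_eq_mul]
        nlinarith
      · obtain rfl : s = 1 - t := by linarith
        ext <;> simp <;> ring
  · rintro _ ⟨p, ⟨hp1, hp2, hp3⟩, rfl⟩
    have h := (convex_convexHull ℝ {A, B, C}).sum_mem (t := Finset.univ)
      (w := ![1 - p.1 - p.2, p.1, p.2]) (z := ![A, B, C]) (by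
        intro i _
        fin_cases i
        · simp only [Fin.zero_eta, Matrix.cons_val_zero]
          linarith
        · exact hp1
        · exact hp2) (by simp [Fin.sum_univ_three]; ring) (by
        intro i _
        apply subset_convexHull
        fin_cases i <;> simp)
    convert h using 1
    rw [Fin.sum_univ_three]
    ext <;> simp <;> ring

lemma bubble_affine {A B C : ℝ × ℝ} (h : det2 (B - A) (C - A) ≠ 0) (p : ℝ × ℝ) :
    bubble A B C (A + p.1 • (B - A) + p.2 • (C - A)) = evalP refBubble p := by
  have hA : det2 (A - B) (C - B) = -det2 (B - A) (C - A) := by simp [det2]; ring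
  have hB : det2 (B - C) (A - C) = -det2 (B - A) (C - A) := by simp [det2]; ring
  have hC : det2 (C - A) (B - A) = -det2 (B - A) (C - A) := by simp [det2]; ring
  have e1 : bary A B C (A + p.1 • (B - A) + p.2 • (C - A)) = 1 - p.1 - p.2 := by
    rw [bary, hA, div_eq_iff (neg_ne_zero.2 h)]
    simp [det2]
    ring
  have e2 : bary B C A (A + p.1 • (B - A) + p.2 • (C - A)) = p.1 := by
    rw [bary, hB, div_eq_iff (neg_ne_zero.2 h)]
    simp [det2]
    ring
  have e3 : bary C A B (A + p.1 • (B - A) + p.2 • (C - A)) = p.2 := by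
    rw [bary, hC, div_eq_iff (neg_ne_zero.2 h)]
    simp [det2]
    ring
  rw [bubble, e1, e2, e3, evalP_refBubble]
  ring

lemma eq_zero_of_smul_add_smul_eq_zero {Q R p : ℝ × ℝ} (h : det2 Q R ≠ 0)
    (hp : p.1 • Q + p.2 • R = 0) : p = 0 := by
  have h1 : p.1 * Q.1 + p.2 * R.1 = 0 := congrArg Prod.fst hp
  have h2 : p.1 * Q.2 + p.2 * R.2 = 0 := congrArg Prod.snd hp
  ext
  · refine (mul_eq_zero.1 (?_ : det2 Q R * p.1 = 0)).resolve_left h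
    rw [det2]
    linear_combination R.2 * h1 - R.1 * h2
  · refine (mul_eq_zero.1 (?_ : det2 Q R * p.2 = 0)).resolve_left h
    rw [det2]
    linear_combination Q.1 * h2 - Q.2 * h1

lemma exists_innerT_eq {A B C : ℝ × ℝ} (h : det2 (B - A) (C - A) ≠ 0) :
    ∃ k : ℝ, k ≠ 0 ∧ ∀ u v, innerT A B C u v =
      k * refInner (affineSubst A (B - A) (C - A) u) (affineSubst A (B - A) (C - A) v) := by
  let L : ℝ × ℝ →L[ℝ] ℝ × ℝ := (ContinuousLinearMap.fst ℝ ℝ ℝ).smulRight (B - A) +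
    (ContinuousLinearMap.snd ℝ ℝ ℝ).smulRight (C - A)
  have hL : ∀ p, L p = p.1 • (B - A) + p.2 • (C - A) := fun p => rfl
  have hdet : L.det ≠ 0 := by
    intro h0
    obtain ⟨p, hp, hp0⟩ := Submodule.exists_mem_ne_zero_of_ne_bot
      (LinearMap.bot_lt_ker_of_det_eq_zero h0).ne'
    exact hp0 (eq_zero_of_smul_add_smul_eq_zero h hp)
  have hderiv : ∀ p ∈ refTriangle, HasFDerivWithinAt
      (fun p : ℝ × ℝ => A + p.1 • (B - A) + p.2 • (C - A)) L refTriangle p := by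
    intro p _
    have := (L.hasFDerivAt (x := p)).const_add A
    simp only [hL, ← add_assoc] at this
    exact this.hasFDerivWithinAt
  have hinj : Set.InjOn (fun p : ℝ × ℝ => A + p.1 • (B - A) + p.2 • (C - A)) refTriangle := by
    intro p _ q _ hpq
    refine sub_eq_zero.1 (eq_zero_of_smul_add_smul_eq_zero h ?_)
    simp only [add_assoc, add_right_inj] at hpq
    rw [Prod.fst_sub, Prod.snd_sub, sub_smul, sub_smul]
    linear_combination (exp := 1) hpq
  refine ⟨|L.det|, abs_ne_zero.2 hdet, fun u v => ?_⟩
  have hae : tri A B C =ᵐ[volume] convexHull ℝ {A, B, C} :=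
    interior_ae_eq_of_null_frontier ((convex_convexHull ℝ _).addHaar_frontier volume)
  rw [innerT, setIntegral_congr_set hae, convexHull_eq_image,
    integral_image_eq_integral_abs_det_fderiv_smul volume isClosed_refTriangle.measurableSet
      hderiv hinj, refInner, ← integral_const_mul]
  simp only [evalP_mul, evalP_affineSubst, bubble_affine h, smul_eq_mul]

lemma inPerp_iff_isEigen {n : ℕ} (hn : 0 < n) {A B C : ℝ × ℝ}
    (h : det2 (B - A) (C - A) ≠ 0) (u : MvPolynomial (Fin 2) ℝ) :
    inPerp n A B C u ↔ IsEigen n (affineSubst A (B - A) (C - A) u) := by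
  obtain ⟨k, hk, hinner⟩ := exists_innerT_eq h
  obtain ⟨P', Q', R', hinv⟩ := exists_affineSubst_inverse A h
  rw [← isRefPerp_iff_isEigen hn, inPerp, IsRefPerp]
  refine and_congr ⟨(totalDegree_affineSubst_le _ _ _ _).trans, fun hd => ?_⟩
    ⟨fun hw w hwd => ?_, fun hw w hwd => ?_⟩
  · rw [← (hinv u).1]
    exact (totalDegree_affineSubst_le _ _ _ _).trans hd
  · have := hw _ ((totalDegree_affineSubst_le P' Q' R' w).trans hwd)
    rw [hinner, (hinv w).2] at this
    exact (mul_eq_zero.1 this).resolve_left hk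
  · rw [hinner, hw _ ((totalDegree_affineSubst_le _ _ _ w).trans hwd), mul_zero]

lemma bary_swap (A B C p : ℝ × ℝ) : bary A B C p = bary A C B p := by
  have h : ∀ q : ℝ × ℝ, det2 (q - C) (B - C) = -det2 (q - B) (C - B) := fun q => by
    simp [det2]
    ring
  rw [bary, bary, h, h, neg_div_neg_eq]

lemma innerT_swap (A B C : ℝ × ℝ) (u v : MvPolynomial (Fin 2) ℝ) :
    innerT B A C u v = innerT A B C u v := by
  have hbub : ∀ p, bubble B A C p = bubble A B C p := fun p => by
    rw [bubble, bubble, bary_swap B A C, bary_swap A C B, bary_swap C B A]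
    ring
  simp only [innerT, hbub, tri, Set.insert_comm B A]

lemma inPerp_swap (n : ℕ) (A B C : ℝ × ℝ) (u : MvPolynomial (Fin 2) ℝ) :
    inPerp n B A C u ↔ inPerp n A B C u := by
  simp only [inPerp, innerT_swap A B C]

/-- The critical set in the affine coordinates in which `D = (a, -b)`. -/
lemma mem_LcritTot_iff {n : ℕ} {A B C D : ℝ × ℝ} {a b : ℝ} (hb : 0 < b)
    (h : det2 (B - A) (C - A) ≠ 0) (hD : D = A + a • (B - A) - b • (C - A)) :
    D ∈ LcritTot n C A B ↔
      a = 0 ∨ a = 1 + b ∨ (n = 2 ∧ b = 1) ∨ (n ≠ 2 ∧ a = 1 ∧ b = 1) := by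
  have hcoord : ∀ a' b' : ℝ, D = A + a' • (B - A) - b' • (C - A) ↔ a = a' ∧ b = b' := by
    intro a' b'
    constructor
    · intro hD'
      have h0 : (a - a', b' - b) = ((0, 0) : ℝ × ℝ) := by
        refine eq_zero_of_smul_add_smul_eq_zero h ?_
        rw [← sub_eq_zero.2 (hD.symm.trans hD')]
        module
      obtain ⟨h1, h2⟩ := Prod.mk.inj h0
      exact ⟨by linarith, by linarith⟩
    · rintro ⟨rfl, rfl⟩
      exact hD
  have hA : D ∈ Lcrit C A ↔ a = 0 := by
    have e : ∀ t : ℝ, C + t • (A - C) = A + (0 : ℝ) • (B - A) - (t - 1) • (C - A) := by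
      intro t
      module
    simp only [Lcrit, Set.mem_ofPred_eq, e, hcoord]
    exact ⟨fun ⟨t, _, h, _⟩ => h, fun h => ⟨b + 1, by linarith, h, by ring⟩⟩
  have hB : D ∈ Lcrit C B ↔ a = 1 + b := by
    have e : ∀ t : ℝ, C + t • (B - C) = A + t • (B - A) - (t - 1) • (C - A) := by
      intro t
      module
    simp only [Lcrit, Set.mem_ofPred_eq, e, hcoord]
    exact ⟨fun ⟨t, _, h, h'⟩ => by linarith, fun h => ⟨a, by linarith, rfl, by linarith⟩⟩
  have hL : D ∈ L2crit C A B ↔ b = 1 := by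
    have e : ∀ t : ℝ, (2 : ℝ) • A - C + t • (B - A) = A + t • (B - A) - (1 : ℝ) • (C - A) := by
      intro t
      module
    simp only [L2crit, Set.mem_ofPred_eq, e, hcoord]
    exact ⟨fun ⟨t, _, h⟩ => h, fun h => ⟨a, rfl, h⟩⟩
  have hQ : D ∈ ({Qcrit C A B} : Set (ℝ × ℝ)) ↔ a = 1 ∧ b = 1 := by
    have e : Qcrit C A B = A + (1 : ℝ) • (B - A) - (1 : ℝ) • (C - A) := by
      rw [Qcrit]
      module
    rw [Set.mem_singleton_iff, e, hcoord]
  by_cases hn : n = 2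
  · rw [LcritTot, if_pos hn, Set.mem_union, Set.mem_union, hA, hB, hL]
    tauto
  · rw [LcritTot, if_neg hn, Set.mem_union, Set.mem_union, hA, hB, hQ]
    tauto

lemma two_mul_param_iff {a b : ℝ} (hb : 0 < b) :
    2 * (a * (a - 1) / (b * (1 + b))) = 2 * a / (1 + b) * (2 * a / (1 + b) - 1) ↔
      a = 0 ∨ a = 1 + b ∨ b = 1 := by
  have hb1 : 0 < 1 + b := by linarith
  have e : 2 * (a * (a - 1) / (b * (1 + b))) - 2 * a / (1 + b) * (2 * a / (1 + b) - 1) =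
      2 / (b * (1 + b) ^ 2) * (a * ((a - (1 + b)) * (1 - b))) := by
    field_simp
    ring
  rw [← sub_eq_zero, e, mul_eq_zero_iff_left (by positivity), mul_eq_zero, mul_eq_zero,
    sub_eq_zero, sub_eq_zero, eq_comm (a := (1 : ℝ))]

/-- The critical condition in terms of the recurrence parameters. -/
lemma critical_iff_params {n : ℕ} {a b : ℝ} (hb : 0 < b) :
    (a = 0 ∨ a = 1 + b ∨ (n = 2 ∧ b = 1) ∨ (n ≠ 2 ∧ a = 1 ∧ b = 1)) ↔
      2 * (a * (a - 1) / (b * (1 + b))) = 2 * a / (1 + b) * (2 * a / (1 + b) - 1) ∧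
      (n = 2 ∨ 2 * a / (1 + b) = 0 ∨ 2 * a / (1 + b) = 1 ∨ 2 * a / (1 + b) = 2) := by
  have hb1 : 0 < 1 + b := by linarith
  rw [two_mul_param_iff hb, div_eq_iff hb1.ne', div_eq_iff hb1.ne', div_eq_iff hb1.ne']
  constructor
  · rintro (rfl | rfl | ⟨h1, h2⟩ | ⟨-, rfl, rfl⟩)
    · simp
    · exact ⟨Or.inr (Or.inl rfl), Or.inr (Or.inr (Or.inr rfl))⟩
    · exact ⟨Or.inr (Or.inr h2), Or.inl h1⟩
    · norm_num
  · rintro ⟨h1 | h1 | rfl, h2⟩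
    · exact Or.inl h1
    · exact Or.inr (Or.inl h1)
    · by_cases hn2 : n = 2
      · exact Or.inr (Or.inr (Or.inl ⟨hn2, rfl⟩))
      · rcases h2 with h2 | h2 | h2 | h2
        · exact absurd h2 hn2
        · exact Or.inl (by linarith)
        · exact Or.inr (Or.inr (Or.inr ⟨hn2, by linarith, rfl⟩))
        · exact Or.inr (Or.inl (by linarith))

/-- Let `n > 1` and let `K₁ = conv°(A,B,C)`, `K₂ = conv°(B,A,D)` be
disjoint open triangles with common edge `AB`, each listed counterclockwise.  Then
`dim (P_{n-1}^⊥(K₁) ∩ P_{n-1}^⊥(K₂))` is `1` if `D ∈ L_crit^{n,tot}(K₁,C)` and `0`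
otherwise. -/
theorem statement12 (n : ℕ) (hn : 1 < n) (A B C D : ℝ × ℝ)
    (hccw1 : 0 < det2 (B - A) (C - A)) (hccw2 : 0 < det2 (A - B) (D - B))
    (hdisj : Disjoint (tri A B C) (tri B A D)) :
    (D ∈ LcritTot n C A B →
      ∃ qn : MvPolynomial (Fin 2) ℝ, qn ≠ 0 ∧
        ∀ u : MvPolynomial (Fin 2) ℝ,
          (inPerp n A B C u ∧ inPerp n B A D u) ↔ ∃ t : ℝ, u = t • qn) ∧
    (D ∉ LcritTot n C A B →
      ∀ u : MvPolynomial (Fin 2) ℝ, inPerp n A B C u → inPerp n B A D u → u = 0) := by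

  have hn0 : 0 < n := by omega
  have hdet := hccw1.ne'
  have hD' : det2 (B - A) (D - A) < 0 := by
    simp only [det2, Prod.fst_sub, Prod.snd_sub] at hccw2 ⊢
    linarith
  let a : ℝ := det2 (D - A) (C - A) / det2 (B - A) (C - A)
  let b : ℝ := -det2 (B - A) (D - A) / det2 (B - A) (C - A)
  have hb : 0 < b := div_pos (neg_pos.2 hD') hccw1
  have hD : D = A + a • (B - A) - b • (C - A) := by
    ext <;> simp [a, b] <;> field_simp <;> simp [det2] <;> ring
  have hboth : ∀ u, (inPerp n A B C u ∧ inPerp n B A D u) ↔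
      IsCommonEigen n (2 * a / (1 + b)) (a * (a - 1) / (b * (1 + b)))
        (affineSubst A (B - A) (C - A) u) := by
    intro u
    rw [inPerp_swap n A B D, inPerp_iff_isEigen hn0 hdet, inPerp_iff_isEigen hn0 hD'.ne,
      ← isEigen_and_iff hb, affineSubst_comp]
    have e1 : A + (0 : ℝ × ℝ).1 • (B - A) + (0 : ℝ × ℝ).2 • (C - A) = A := by simp
    have e2 : (1 : ℝ) • (B - A) + (0 : ℝ) • (C - A) = B - A := by simp
    have e3 : a • (B - A) + (-b) • (C - A) = D - A := by
      conv_rhs => rw [hD]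
      module
    rw [e1, e2, e3]
  obtain ⟨P', Q', R', hinv⟩ := exists_affineSubst_inverse A hdet
  rw [mem_LcritTot_iff hb hdet hD, critical_iff_params hb]
  constructor
  · rintro ⟨hp, hσ⟩
    obtain ⟨q, hq0, hq⟩ := exists_isCommonEigen hp hσ
    refine ⟨affineSubst P' Q' R' q, fun h => hq0 ?_, fun u => ?_⟩
    · rw [← (hinv q).2, h, map_zero]
    · rw [hboth]
      constructor
      · intro hu
        refine ⟨cf (affineSubst A (B - A) (C - A) u) n 0 / cf q n 0, ?_⟩
        rw [← map_smul, ← hu.eq_smul hq hq0, (hinv u).1]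
      · rintro ⟨t, rfl⟩
        rw [map_smul, (hinv q).2]
        exact hq.smul t
  · intro hcrit u h1 h2
    by_contra hu
    have hc := (hboth u).1 ⟨h1, h2⟩
    have hne : affineSubst A (B - A) (C - A) u ≠ 0 := fun h => hu (by
      rw [← (hinv u).1, h, map_zero])
    refine hcrit ⟨hc.two_mul_param hn hne, ?_⟩
    by_cases hn2 : n = 2
    · exact Or.inl hn2
    · exact Or.inr (hc.param_cases (by omega) hne)
end
end

section
/- Let 𝒯 = {K_1, …, K_q} be a triangle patch around z ∈ ℝ² and let M_i denote the barycenter of K_i. Then the points M_1, …, M_q are not all collinear; in particular, there exists an index i such that the barycenters M_{i−1}, M_i, M_{i+1} of three consecutive triangles are affinely independent (not collinear). -/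
open MeasureTheory Finset

noncomputable section

/-- A triangle patch around a point `z`: `q ≥ 3` pairwise disjoint nondegenerate open
triangles `K_i = conv°(z, A_{i-1}, A_i)` (indices cyclic, i.e. in `ZMod q`), consecutive ones
sharing the edge from `z` to `A_i`, whose closed union covers a neighbourhood of `z`. -/
structure TrianglePatch (q : ℕ) where
  hq : 3 ≤ q
  z : ℝ × ℝ
  A : ZMod q → ℝ × ℝ
  indep : ∀ i : ZMod q, AffineIndependent ℝ ![z, A (i - 1), A i]
  disj : Pairwise fun i j : ZMod q =>
    Disjoint (tri z (A (i - 1)) (A i)) (tri z (A (j - 1)) (A j))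
  covers : ∃ ε > 0, Metric.ball z ε ⊆ ⋃ i : ZMod q, closure (tri z (A (i - 1)) (A i))

/-- The `i`-th triangle of a patch. -/
def TrianglePatch.K {q : ℕ} (T : TrianglePatch q) (i : ZMod q) : Set (ℝ × ℝ) :=
  tri T.z (T.A (i - 1)) (T.A i)

/-- `Ω`: the interior of the union of the closed triangles of the patch. -/
def TrianglePatch.Omega {q : ℕ} (T : TrianglePatch q) : Set (ℝ × ℝ) :=
  interior (⋃ i : ZMod q, closure (tri T.z (T.A (i - 1)) (T.A i)))

/-- The patch inner product `(u,v)_𝒯 = Σ_i (u_i, v_i)_{K_i}` of two piecewise polynomials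
(given as tuples of polynomials, one for each triangle). -/
def patchInner {q : ℕ} (T : TrianglePatch q)
    (u v : ZMod q → MvPolynomial (Fin 2) ℝ) : ℝ :=
  haveI : NeZero q := ⟨by have := T.hq; omega⟩
  ∑ i : ZMod q, innerT T.z (T.A (i - 1)) (T.A i) (u i) (v i)

/-- The barycenter `M_i = (z + A_{i-1} + A_i)/3` of the `i`-th triangle of a patch. -/
def TrianglePatch.M {q : ℕ} (T : TrianglePatch q) (i : ZMod q) : ℝ × ℝ :=
  (3⁻¹ : ℝ) • (T.z + T.A (i - 1) + T.A i)

lemma det2_sub_ne_zero_of_affineIndependent {z a b : ℝ × ℝ}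
    (h : AffineIndependent ℝ ![z, a, b]) : det2 (a - z) (b - z) ≠ 0 := by
  intro hd
  rw [affineIndependent_iff_not_collinear_set] at h
  apply h
  rw [collinear_iff_of_mem (p₀ := z) (by simp)]
  simp only [det2, Prod.fst_sub, Prod.snd_sub] at hd
  by_cases ha : a = z
  · refine ⟨b - z, ?_⟩
    rintro p (rfl | rfl | rfl)
    · exact ⟨0, by simp⟩
    · exact ⟨0, by simp [ha]⟩
    · exact ⟨1, by simp⟩
  · refine ⟨a - z, ?_⟩
    have hn : (a.1 - z.1) ^ 2 + (a.2 - z.2) ^ 2 ≠ 0 := by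
      intro h0
      apply ha
      ext <;> nlinarith [sq_nonneg (a.1 - z.1), sq_nonneg (a.2 - z.2)]
    rintro p (rfl | rfl | rfl)
    · exact ⟨0, by simp⟩
    · exact ⟨1, by simp⟩
    · refine ⟨((a.1 - z.1) * (p.1 - z.1) + (a.2 - z.2) * (p.2 - z.2)) /
        ((a.1 - z.1) ^ 2 + (a.2 - z.2) ^ 2), ?_⟩
      ext
      · simp only [vadd_eq_add, Prod.fst_add, Prod.smul_fst, Prod.fst_sub, smul_eq_mul]
        field_simp
        linear_combination (-(a.2 - z.2)) * hd
      · simp only [vadd_eq_add, Prod.snd_add, Prod.smul_snd, Prod.snd_sub, smul_eq_mul]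
        field_simp
        linear_combination (a.1 - z.1) * hd

lemma det2_sub_eq_zero_of_collinear {p q r : ℝ × ℝ} (h : Collinear ℝ {p, q, r}) :
    det2 (q - p) (r - q) = 0 := by
  rw [collinear_iff_of_mem (p₀ := p) (by simp)] at h
  obtain ⟨v, hv⟩ := h
  obtain ⟨s, rfl⟩ := hv q (by simp)
  obtain ⟨t, rfl⟩ := hv r (by simp)
  simp only [det2, vadd_eq_add, Prod.fst_sub, Prod.snd_sub, Prod.fst_add, Prod.snd_add,
    Prod.smul_fst, Prod.smul_snd, smul_eq_mul]
  ring

lemma continuous_det2_sub (z v : ℝ × ℝ) : Continuous fun x => det2 v (x - z) := by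
  unfold det2
  fun_prop

/-- A point with positive barycentric coordinates lies in the open triangle. -/
lemma add_smul_sub_mem_tri {z a b : ℝ × ℝ} (hd : det2 (a - z) (b - z) ≠ 0) {l m : ℝ}
    (hl : 0 < l) (hm : 0 < m) (hlm : l + m < 1) :
    z + (l • (a - z) + m • (b - z)) ∈ tri z a b := by
  set f : ℝ × ℝ → ℝ := fun x => -det2 (b - z) (x - z) / det2 (a - z) (b - z) with hf
  set g : ℝ × ℝ → ℝ := fun x => det2 (a - z) (x - z) / det2 (a - z) (b - z) with hg
  have hfc : Continuous f := (continuous_det2_sub z (b - z)).neg.div_const _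
  have hgc : Continuous g := (continuous_det2_sub z (a - z)).div_const _
  have hsub : {x | 0 < f x ∧ 0 < g x ∧ f x + g x < 1} ⊆ convexHull ℝ {z, a, b} := by
    rintro x ⟨h1, h2, h3⟩
    have hx : x = (1 - f x - g x) • z + f x • a + g x • b := by
      simp only [hf, hg]
      generalize hD : det2 (a - z) (b - z) = D at hd
      ext <;> simp only [det2, Prod.fst_add, Prod.snd_add, Prod.smul_fst, Prod.smul_snd,
        Prod.fst_sub, Prod.snd_sub, smul_eq_mul] at hD ⊢ <;> field_simp <;> rw [← hD] <;> ring
    have hc := convex_convexHull ℝ ({z, a, b} : Set (ℝ × ℝ))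
    have hs := subset_convexHull ℝ ({z, a, b} : Set (ℝ × ℝ))
    rw [hx]
    have hsum := hc.sum_mem (t := Finset.univ) (w := ![1 - f x - g x, f x, g x]) (z := ![z, a, b])
      (by intro i _; fin_cases i <;> simp <;> linarith)
      (by simp [Fin.sum_univ_three]; ring) (by intro i _; fin_cases i <;> exact hs (by simp))
    simpa [Fin.sum_univ_three] using hsum
  refine mem_interior.mpr ⟨_, hsub, ?_, ?_⟩
  · exact (isOpen_lt continuous_const hfc).inter
      ((isOpen_lt continuous_const hgc).inter (isOpen_lt (hfc.add hgc) continuous_const))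
  · have h1 : f (z + (l • (a - z) + m • (b - z))) = l := by
      rw [hf]
      dsimp only
      rw [div_eq_iff hd]
      simp only [det2, Prod.fst_add, Prod.snd_add, Prod.smul_fst, Prod.smul_snd,
        Prod.fst_sub, Prod.snd_sub, smul_eq_mul]
      ring
    have h2 : g (z + (l • (a - z) + m • (b - z))) = m := by
      rw [hg]
      dsimp only
      rw [div_eq_iff hd]
      simp only [det2, Prod.fst_add, Prod.snd_add, Prod.smul_fst, Prod.smul_snd,
        Prod.fst_sub, Prod.snd_sub, smul_eq_mul]
      ring
    simp only [Set.mem_ofPred_eq, h1, h2]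
    exact ⟨hl, hm, hlm⟩

/-- Two triangles at `z` whose open cones share a direction are not disjoint. -/
lemma not_disjoint_tri_of_common_direction {z a b c d w : ℝ × ℝ}
    (hab : det2 (a - z) (b - z) ≠ 0) (hcd : det2 (c - z) (d - z) ≠ 0)
    (h₁ : ∃ l m : ℝ, 0 < l ∧ 0 < m ∧ w = l • (a - z) + m • (b - z))
    (h₂ : ∃ l m : ℝ, 0 < l ∧ 0 < m ∧ w = l • (c - z) + m • (d - z)) :
    ¬ Disjoint (tri z a b) (tri z c d) := by
  obtain ⟨l, m, hl, hm, hw⟩ := h₁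
  obtain ⟨l', m', hl', hm', hw'⟩ := h₂
  have key : ∀ {x y : ℝ × ℝ} {r s : ℝ}, det2 (x - z) (y - z) ≠ 0 → 0 < r → 0 < s →
      r + s < 1 + l + m + l' + m' → w = r • (x - z) + s • (y - z) →
      z + (1 + l + m + l' + m')⁻¹ • w ∈ tri z x y := by
    intro x y r s hxy hr hs hrs hw
    rw [hw, smul_add, smul_smul, smul_smul]
    have hS : 0 < 1 + l + m + l' + m' := by positivity
    refine add_smul_sub_mem_tri hxy (by positivity) (by positivity) ?_
    rw [← mul_add, inv_mul_lt_iff₀ hS]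
    linarith
  exact Set.not_disjoint_iff.mpr
    ⟨_, key hab hl hm (by linarith) hw, key hcd hl' hm' (by linarith) hw'⟩

/-- If `a` and `b` lie strictly on opposite sides of the line `ℝ v`, then the open cone spanned
by `a` and `b` contains `v` or `-v`. -/
lemma mem_cone_or_neg_mem_cone {a b v : ℝ × ℝ} (hab : det2 a b ≠ 0)
    (h : det2 v a * det2 v b < 0) :
    (∃ l m : ℝ, 0 < l ∧ 0 < m ∧ v = l • a + m • b) ∨
      ∃ l m : ℝ, 0 < l ∧ 0 < m ∧ -v = l • a + m • b := by
  have hcomb : v = (det2 v b / det2 a b) • a + (-det2 v a / det2 a b) • b := by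
    generalize hD : det2 a b = D at hab
    ext <;> simp only [det2, Prod.fst_add, Prod.snd_add, Prod.smul_fst, Prod.smul_snd,
      smul_eq_mul] at hD ⊢ <;> field_simp <;> rw [← hD] <;> ring
  have hlm : 0 < (det2 v b / det2 a b) * (-det2 v a / det2 a b) := by
    rw [div_mul_div_comm]
    exact div_pos (by linarith) (mul_self_pos.mpr hab)
  rcases pos_and_pos_or_neg_and_neg_of_mul_pos hlm with ⟨h1, h2⟩ | ⟨h1, h2⟩
  · exact .inl ⟨_, _, h1, h2, hcomb⟩
  · refine .inr ⟨_, _, neg_pos.mpr h1, neg_pos.mpr h2, ?_⟩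
    rw [neg_smul, neg_smul, ← neg_add, ← hcomb]

namespace TrianglePatch

variable {q : ℕ} (T : TrianglePatch q)

lemma exists_det2_neg {v : ℝ × ℝ} (hv : v ≠ 0) : ∃ i, det2 v (T.A i - T.z) < 0 := by
  by_contra! hpos
  obtain ⟨ε, hε, hcov⟩ := T.covers
  have hlim : Filter.Tendsto (fun t : ℝ => T.z + t • ((v.2, -v.1) : ℝ × ℝ))
      (nhdsWithin 0 (Set.Ioi 0)) (nhds T.z) := by
    have hc : Continuous (fun t : ℝ => T.z + t • ((v.2, -v.1) : ℝ × ℝ)) := by fun_prop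
    simpa using (hc.tendsto 0).mono_left nhdsWithin_le_nhds
  obtain ⟨t, htball, ht⟩ :=
    ((hlim.eventually (Metric.ball_mem_nhds _ hε)).and self_mem_nhdsWithin).exists
  obtain ⟨i, hi⟩ := Set.mem_iUnion.mp (hcov htball)
  have hclosed : IsClosed {x | 0 ≤ det2 v (x - T.z)} :=
    isClosed_le continuous_const (continuous_det2_sub _ _)
  have hconv : Convex ℝ {x | 0 ≤ det2 v (x - T.z)} := by
    intro x hx y hy a b ha hb hab
    have hx' := mul_nonneg ha (Set.mem_ofPred_eq ▸ hx)
    have hy' := mul_nonneg hb (Set.mem_ofPred_eq ▸ hy)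
    simp only [det2, Set.mem_ofPred_eq, Prod.fst_add, Prod.snd_add, Prod.smul_fst, Prod.smul_snd,
      Prod.fst_sub, Prod.snd_sub, smul_eq_mul] at hx' hy' ⊢
    obtain rfl : b = 1 - a := by linarith
    linarith
  have hsub : closure (tri T.z (T.A (i - 1)) (T.A i)) ⊆ {x | 0 ≤ det2 v (x - T.z)} := by
    refine closure_minimal (interior_subset.trans (convexHull_min ?_ hconv)) hclosed
    rintro x (rfl | rfl | rfl)
    · simp [det2]
    · exact hpos _
    · exact hpos _
  have hmem := hsub hi
  simp only [det2, Set.mem_ofPred_eq, Prod.fst_add, Prod.snd_add, Prod.smul_fst, Prod.smul_snd,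
    Prod.fst_sub, Prod.snd_sub, smul_eq_mul] at hmem
  have hsq : v.1 ^ 2 + v.2 ^ 2 ≤ 0 := by
    by_contra! h
    nlinarith [mul_pos (Set.mem_Ioi.mp ht) h]
  exact hv (Prod.ext (by simp only [Prod.fst_zero]; nlinarith [sq_nonneg v.1, sq_nonneg v.2])
    (by simp only [Prod.snd_zero]; nlinarith [sq_nonneg v.1, sq_nonneg v.2]))

lemma det2_ne_zero (i : ZMod q) : det2 (T.A (i - 1) - T.z) (T.A i - T.z) ≠ 0 :=
  det2_sub_ne_zero_of_affineIndependent (T.indep i)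

lemma eq_of_common_direction {w : ℝ × ℝ} {i j : ZMod q}
    (hi : ∃ l m : ℝ, 0 < l ∧ 0 < m ∧ w = l • (T.A (i - 1) - T.z) + m • (T.A i - T.z))
    (hj : ∃ l m : ℝ, 0 < l ∧ 0 < m ∧ w = l • (T.A (j - 1) - T.z) + m • (T.A j - T.z)) :
    i = j :=
  not_imp_comm.mp (fun h => T.disj h)
    (not_disjoint_tri_of_common_direction (T.det2_ne_zero i) (T.det2_ne_zero j) hi hj)

lemma M_succ_sub (i : ZMod q) : T.M (i + 1) - T.M i = (3⁻¹ : ℝ) • (T.A (i + 1) - T.A (i - 1)) := by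
  simp only [M, add_sub_cancel_right]
  module

lemma natCast_ne_zero {q n : ℕ} (T : TrianglePatch q) (h0 : 0 < n) (hn : n < 3) :
    (n : ZMod q) ≠ 0 := by
  rw [Ne, ZMod.natCast_eq_zero_iff]
  exact fun h => by have := Nat.le_of_dvd h0 h; have := T.hq; omega

lemma M_succ_sub_ne_zero (i : ZMod q) : T.M (i + 1) - T.M i ≠ 0 := by
  rw [M_succ_sub, smul_ne_zero_iff]
  refine ⟨by norm_num, fun h => ?_⟩
  have h1 : i = i + 1 := by
    refine T.eq_of_common_direction ⟨1, 1, one_pos, one_pos, rfl⟩ ⟨1, 1, one_pos, one_pos, ?_⟩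
    rw [add_sub_cancel_right, sub_eq_zero.mp h, add_comm]
  exact T.natCast_ne_zero one_pos (by norm_num) (by simpa using h1)

/-- Signed distances of the outer vertices to a line through `z` are not two-periodic. -/
lemma not_forall_det2_eq {v : ℝ × ℝ} (hv : v ≠ 0) :
    ¬ ∀ i, det2 v (T.A (i + 1) - T.z) = det2 v (T.A (i - 1) - T.z) := by
  intro h
  have : NeZero q := ⟨by have := T.hq; omega⟩
  obtain ⟨i, hi⟩ := T.exists_det2_neg hv
  obtain ⟨k, hk⟩ := T.exists_det2_neg (neg_ne_zero.mpr hv)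
  set f : ZMod q → ℝ := fun j => det2 v (T.A j - T.z) with hf
  change ∀ i, f (i + 1) = f (i - 1) at h
  change f i < 0 at hi
  have hk : 0 < f k := by
    simp only [hf, det2, Prod.fst_neg, Prod.snd_neg] at hk ⊢
    linarith
  have hstep (n : ℕ) : (f (i + n - 1) = f (i - 1) ∧ f (i + n) = f i) ∨
      (f (i + n - 1) = f i ∧ f (i + n) = f (i - 1)) := by
    induction n with
    | zero => simp
    | succ n ih =>
      have := h (i + n)
      rw [Nat.cast_succ, ← add_assoc, add_sub_cancel_right, this]
      tauto
  have hall (j : ZMod q) : (f (j - 1) = f (i - 1) ∧ f j = f i) ∨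
      (f (j - 1) = f i ∧ f j = f (i - 1)) := by
    simpa using hstep (j - i).val
  have hpred : 0 < f (i - 1) := by
    rcases hall k with ⟨-, hk'⟩ | ⟨-, hk'⟩ <;> linarith
  have hcone (j : ZMod q) := mem_cone_or_neg_mem_cone (T.det2_ne_zero j) (by
    change f (j - 1) * f j < 0
    rcases hall j with ⟨h1, h2⟩ | ⟨h1, h2⟩ <;> rw [h1, h2] <;> nlinarith)
  have h01 : (0 : ZMod q) ≠ 1 := fun h0 =>
    T.natCast_ne_zero one_pos (by norm_num) (by simpa using h0.symm)
  have h02 : (0 : ZMod q) ≠ 2 := fun h0 =>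
    T.natCast_ne_zero two_pos (by norm_num) (by simpa using h0.symm)
  have h12 : (1 : ZMod q) ≠ 2 := fun h0 => h01 (by linear_combination h0)
  rcases hcone 0 with h0 | h0 <;> rcases hcone 1 with h1 | h1 <;> rcases hcone 2 with h2 | h2 <;>
    first
    | exact h01 (T.eq_of_common_direction h0 h1)
    | exact h02 (T.eq_of_common_direction h0 h2)
    | exact h12 (T.eq_of_common_direction h1 h2)

/-- Some three consecutive barycenters of a triangle patch are not collinear. -/
lemma exists_not_collinear_barycenters :
    ∃ i : ZMod q, ¬ Collinear ℝ ({T.M (i - 1), T.M i, T.M (i + 1)} : Set (ℝ × ℝ)) := by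
  by_contra! h
  have : NeZero q := ⟨by have := T.hq; omega⟩
  set v := T.M (0 + 1) - T.M 0 with hv
  have hv0 : v ≠ 0 := T.M_succ_sub_ne_zero 0
  have hpar (n : ℕ) : det2 v (T.M (n + 1) - T.M n) = 0 := by
    induction n with
    | zero => simp only [Nat.cast_zero, ← hv, det2]; ring
    | succ n ih =>
      have hdet := det2_sub_eq_zero_of_collinear (h (n + 1))
      rw [add_sub_cancel_right] at hdet
      rw [Nat.cast_succ]
      have hu := T.M_succ_sub_ne_zero n
      generalize T.M (n + 1) - T.M n = u at *
      generalize T.M (n + 1 + 1) - T.M (n + 1) = w at *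
      simp only [det2] at *
      have h1 : u.1 * (v.1 * w.2 - v.2 * w.1) = 0 := by
        linear_combination v.1 * hdet + w.1 * ih
      have h2 : u.2 * (v.1 * w.2 - v.2 * w.1) = 0 := by
        linear_combination v.2 * hdet + w.2 * ih
      by_contra hne
      exact hu (Prod.ext ((mul_eq_zero.mp h1).resolve_right hne)
        ((mul_eq_zero.mp h2).resolve_right hne))
  refine T.not_forall_det2_eq hv0 fun i => ?_
  have hi := hpar i.val
  rw [ZMod.natCast_zmod_val, M_succ_sub] at hi
  simp only [det2, Prod.smul_fst, Prod.smul_snd, Prod.fst_sub, Prod.snd_sub,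
    smul_eq_mul] at hi ⊢
  linear_combination 3 * hi

end TrianglePatch

/-- For a triangle patch `𝒯 = {K_1, …, K_q}` around `z`, the barycenters
`M_1, …, M_q` are not all collinear; in particular some three consecutive barycenters
`M_{i-1}, M_i, M_{i+1}` are not collinear. -/
theorem statement13 (q : ℕ) (T : TrianglePatch q) :
    ¬ Collinear ℝ (Set.range T.M) ∧
      ∃ i : ZMod q, ¬ Collinear ℝ ({T.M (i - 1), T.M i, T.M (i + 1)} : Set (ℝ × ℝ)) := by
  refine ⟨fun h => ?_, T.exists_not_collinear_barycenters⟩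
  obtain ⟨i, hi⟩ := T.exists_not_collinear_barycenters
  refine hi (h.subset ?_)
  rintro p (rfl | rfl | rfl) <;> exact Set.mem_range_self _
end
end
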